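/- arXiv:1108.4132 — 7 statements merged into one kernel-verified Lean document; each statement's English description precedes it below -/
import Mathlib

section
/- Let q be a prime power, d a nonnegative integer, and k an integer with 1 ≤ k ≤ d+1. Then the sum, over all polynomials f ∈ F_q[x] with deg(f) ≤ d, of the number of k-cycles of f acting on F_q, equals (q(q−1)⋯(q−(k−1))/k) · q^{d−k+1}. -/
open Polynomial

/-- `c` is a cycle of the map `φ`: a nonempty finite set, closed under `φ`, on which `φ` acts
transitively (equivalently, an orbit of periodic points `α₁ → α₂ → ⋯ → α_k → α₁`). -/
def IsCycleSet {S : Type*} (φ : S → S) (c : Finset S) : Prop :=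
  c.Nonempty ∧ (∀ x ∈ c, φ x ∈ c) ∧ ∀ x ∈ c, ∀ y ∈ c, ∃ j : ℕ, φ^[j] x = y

open Function

theorem IsCycleSet.minimalPeriod_pos {S : Type*} {φ : S → S} {c : Finset S}
    (hc : IsCycleSet φ c) {x : S} (hx : x ∈ c) : 0 < minimalPeriod φ x := by
  obtain ⟨j, hj⟩ := hc.2.2 (φ x) (hc.2.1 x hx) x hx
  exact IsPeriodicPt.minimalPeriod_pos j.succ_pos hj

theorem IsCycleSet.iterate_mem {S : Type*} {φ : S → S} {c : Finset S}
    (hc : IsCycleSet φ c) {x : S} (hx : x ∈ c) (n : ℕ) : φ^[n] x ∈ c := by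
  induction n with
  | zero => exact hx
  | succ n ih => rw [iterate_succ_apply']; exact hc.2.1 _ ih

theorem IsCycleSet.eq_image {S : Type*} [DecidableEq S] {φ : S → S} {c : Finset S}
    (hc : IsCycleSet φ c) {x : S} (hx : x ∈ c) :
    c = (Finset.range (minimalPeriod φ x)).image (fun n => φ^[n] x) := by
  ext y
  simp only [Finset.mem_image, Finset.mem_range]
  constructor
  · intro hy
    obtain ⟨j, rfl⟩ := hc.2.2 x hx y hy
    exact ⟨j % minimalPeriod φ x, Nat.mod_lt _ (hc.minimalPeriod_pos hx),
      iterate_mod_minimalPeriod_eq⟩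
  · rintro ⟨n, -, rfl⟩
    exact hc.iterate_mem hx n

theorem card_image_iterate_minimalPeriod {S : Type*} [DecidableEq S] (φ : S → S) (x : S) :
    ((Finset.range (minimalPeriod φ x)).image (fun n => φ^[n] x)).card = minimalPeriod φ x := by
  rw [Finset.card_image_of_injOn, Finset.card_range]
  rw [Finset.coe_range]
  exact iterate_injOn_Iio_minimalPeriod

theorem isCycleSet_image_iterate {S : Type*} [DecidableEq S] {φ : S → S} {x : S}
    (hx : 0 < minimalPeriod φ x) :
    IsCycleSet φ ((Finset.range (minimalPeriod φ x)).image (fun n => φ^[n] x)) := by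
  refine ⟨⟨x, Finset.mem_image.2 ⟨0, Finset.mem_range.2 hx, rfl⟩⟩, ?_, ?_⟩
  · intro y hy
    obtain ⟨n, -, rfl⟩ := Finset.mem_image.1 hy
    refine Finset.mem_image.2 ⟨(n + 1) % minimalPeriod φ x,
      Finset.mem_range.2 (Nat.mod_lt _ hx), ?_⟩
    simp only [iterate_mod_minimalPeriod_eq, iterate_succ_apply']
  · intro y hy z hz
    obtain ⟨n, hn, rfl⟩ := Finset.mem_image.1 hy
    obtain ⟨m, -, rfl⟩ := Finset.mem_image.1 hz
    rw [Finset.mem_range] at hn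
    refine ⟨m + (minimalPeriod φ x - n), ?_⟩
    rw [← iterate_add_apply, add_assoc, Nat.sub_add_cancel hn.le, iterate_add_apply,
      iterate_minimalPeriod]

/-- A `k`-cycle with a marked point is the same as a point of minimal period `k`. -/
noncomputable def markedCycleEquiv {S : Type*} (φ : S → S) {k : ℕ} (hk : 0 < k) :
    (Σ c : {c : Finset S // IsCycleSet φ c ∧ c.card = k}, c.1) ≃
      {x : S // minimalPeriod φ x = k} := by
  classical
  exact
  { toFun := fun p => ⟨p.2.1, by
      rw [← card_image_iterate_minimalPeriod, ← p.1.2.1.eq_image p.2.2, p.1.2.2]⟩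
    invFun := fun x =>
      ⟨⟨(Finset.range (minimalPeriod φ x.1)).image (fun n => φ^[n] x.1),
        isCycleSet_image_iterate (x.2.symm ▸ hk),
        (card_image_iterate_minimalPeriod φ x.1).trans x.2⟩,
        ⟨x.1, Finset.mem_image.2 ⟨0, Finset.mem_range.2 (x.2.symm ▸ hk), rfl⟩⟩⟩
    left_inv := by
      rintro ⟨⟨c, hc⟩, ⟨x, hx⟩⟩
      have h := hc.1.eq_image hx
      dsimp only at h hx ⊢
      congr! 2
      · exact h.symm
      · exact congrArg (fun s : Finset S => (· ∈ s)) h.symm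
    right_inv := fun _ => rfl }

theorem iterate_apply_zero_of_forall_apply {S : Type*} {φ : S → S} {k : ℕ} [NeZero k]
    {a : Fin k → S} (ha : ∀ i, φ (a i) = a (i + 1)) (n : ℕ) : φ^[n] (a 0) = a (Fin.ofNat k n) := by
  induction n with
  | zero => rfl
  | succ n ih =>
    rw [iterate_succ_apply', ih, ha]
    congr 1
    ext
    simp [Fin.val_add]

/-- A point of minimal period `k` is the same as an injective `k`-periodic sequence of iterates. -/
noncomputable def cyclicEmbeddingEquiv {S : Type*} (φ : S → S) (k : ℕ) [NeZero k] :
    {a : Fin k ↪ S // ∀ i, φ (a i) = a (i + 1)} ≃ {x : S // minimalPeriod φ x = k} where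
  toFun a := ⟨a.1 0, by
    have h := iterate_apply_zero_of_forall_apply a.2
    apply Nat.dvd_antisymm
    · apply IsPeriodicPt.minimalPeriod_dvd
      rw [IsPeriodicPt, IsFixedPt, h, Fin.ofNat_self]
    · have h0 : Fin.ofNat k (minimalPeriod φ (a.1 0)) = 0 := by
        apply a.1.injective
        rw [← h, iterate_minimalPeriod]
      exact Nat.dvd_of_mod_eq_zero (congrArg Fin.val h0)⟩
  invFun x := ⟨⟨fun i => φ^[i] x.1, fun i j hij => Fin.ext <|
      iterate_injOn_Iio_minimalPeriod (f := φ) (x := x.1) (by simp [x.2]) (by simp [x.2]) hij⟩, by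
    intro i
    obtain ⟨x, rfl⟩ := x
    change φ (φ^[i] x) = φ^[(i + 1 : Fin _).val] x
    rw [Fin.val_add, Fin.val_one', Nat.add_mod_mod, iterate_mod_minimalPeriod_eq,
      iterate_succ_apply']⟩
  left_inv a := by
    ext i
    change φ^[i] (a.1 0) = a.1 i
    rw [iterate_apply_zero_of_forall_apply a.2, Fin.ofNat_val_eq_self]
  right_inv x := rfl

/-- Each `k`-cycle has `k` cyclic parametrizations. -/
theorem card_cycles_mul {S : Type*} [Finite S] (φ : S → S) (k : ℕ) [NeZero k] :
    Nat.card {c : Finset S // IsCycleSet φ c ∧ c.card = k} * k =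
      Nat.card {a : Fin k ↪ S // ∀ i, φ (a i) = a (i + 1)} := by
  have := Fintype.ofFinite {c : Finset S // IsCycleSet φ c ∧ c.card = k}
  rw [Nat.card_congr (cyclicEmbeddingEquiv φ k),
    ← Nat.card_congr (markedCycleEquiv φ (NeZero.pos k)), Nat.card_sigma]
  simp [fun c : {c : Finset S // IsCycleSet φ c ∧ c.card = k} => c.2.2]

/-- The number of polynomials of degree less than `n` with prescribed values at `k ≤ n` points. -/
theorem card_degreeLT_eval_eq {F : Type*} [Field F] [Finite F] {k n : ℕ} (hkn : k ≤ n)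
    (a : Fin k ↪ F) (b : Fin k → F) :
    Nat.card {f : degreeLT F n // ∀ i, f.1.eval (a i) = b i} = Nat.card F ^ (n - k) := by
  let L : degreeLT F n →ₗ[F] (Fin k → F) :=
    (LinearMap.pi fun i => leval (a i)) ∘ₗ (degreeLT F n).subtype
  have hLapply (f : degreeLT F n) (i : Fin k) : L f i = f.1.eval (a i) := rfl
  have hfin : Module.Finite F (degreeLT F n) := Module.Finite.equiv (degreeLTEquiv F n).symm
  have hrank : Module.finrank F (degreeLT F n) = n := by
    rw [(degreeLTEquiv F n).finrank_eq, Module.finrank_fin_fun]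
  have hsurj (v : Fin k → F) : ∃ f, L f = v := by
    have hinj : Set.InjOn a (Finset.univ : Finset (Fin k)) := a.injective.injOn
    refine ⟨⟨Lagrange.interpolate Finset.univ a v, mem_degreeLT.2 ?_⟩, ?_⟩
    · refine (Lagrange.degree_interpolate_lt v hinj).trans_le ?_
      simpa using hkn
    · ext i
      rw [hLapply]
      exact Lagrange.eval_interpolate_at_node v hinj (Finset.mem_univ i)
  have hker : Module.finrank F (LinearMap.ker L) = n - k := by
    have h := L.finrank_range_add_finrank_ker
    rw [LinearMap.range_eq_top.2 hsurj, finrank_top, Module.finrank_fin_fun, hrank] at h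
    omega
  obtain ⟨f₀, hf₀⟩ := hsurj b
  have e : {f : degreeLT F n // ∀ i, f.1.eval (a i) = b i} ≃ LinearMap.ker L :=
    (Equiv.subRight f₀).subtypeEquiv fun f => by
      rw [LinearMap.mem_ker, Equiv.subRight_apply, map_sub, sub_eq_zero, hf₀, funext_iff]
      rfl
  rw [Nat.card_congr e, Module.natCard_eq_pow_finrank (K := F), hker]

theorem mem_degreeLT_succ {R : Type*} [Semiring R] {f : R[X]} {d : ℕ} :
    f ∈ degreeLT R (d + 1) ↔ f.degree ≤ d := by
  rw [mem_degreeLT, degree_lt_iff_coeff_zero, degree_le_iff_coeff_zero]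
  simp

/-- Reassociates pairs of a bounded-degree polynomial and one of its cycles into a sigma type. -/
noncomputable def polynomialCycleEquiv (F : Type*) [Field F] (d k : ℕ) :
    {p : Polynomial F × Finset F // p.1.degree ≤ (d : WithBot ℕ) ∧
        IsCycleSet (fun x => p.1.eval x) p.2 ∧ p.2.card = k} ≃
      Σ f : degreeLT F (d + 1),
        {c : Finset F // IsCycleSet (fun x => f.1.eval x) c ∧ c.card = k} where
  toFun p := ⟨⟨p.1.1, mem_degreeLT_succ.2 p.2.1⟩, ⟨p.1.2, p.2.2⟩⟩
  invFun s := ⟨(s.1.1, s.2.1), mem_degreeLT_succ.1 s.1.2, s.2.2⟩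
  left_inv _ := rfl
  right_inv _ := rfl

/-- **Lemma 2.1.** For `1 ≤ k ≤ d + 1`, the sum over all polynomials `f ∈ F_q[x]` of degree at
most `d` of the number of `k`-cycles of `f` acting on `F_q` equals
`(q(q-1)⋯(q-(k-1))/k) ⬝ q^(d-k+1)`. -/
theorem sum_k_cycles_of_polynomials_of_degree_le
    (q d k : ℕ) (F : Type) [Field F] [Fintype F] (hF : Fintype.card F = q)
    (hk1 : 1 ≤ k) (hk2 : k ≤ d + 1) :
    (Nat.card {p : Polynomial F × Finset F //
        p.1.degree ≤ (d : WithBot ℕ) ∧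
          IsCycleSet (fun x => p.1.eval x) p.2 ∧ p.2.card = k} : ℚ)
      = (∏ j ∈ Finset.range k, ((q : ℚ) - j)) / k * (q : ℚ) ^ (d + 1 - k) := by
  have : NeZero k := ⟨by omega⟩
  have : Finite (degreeLT F (d + 1)) := Finite.of_equiv _ (degreeLTEquiv F (d + 1)).symm.toEquiv
  have := Fintype.ofFinite (degreeLT F (d + 1))
  have key : Nat.card {p : Polynomial F × Finset F //
        p.1.degree ≤ (d : WithBot ℕ) ∧
          IsCycleSet (fun x => p.1.eval x) p.2 ∧ p.2.card = k} * k =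
      q.descFactorial k * q ^ (d + 1 - k) := by
    let e : (Σ f : degreeLT F (d + 1),
          {a : Fin k ↪ F // ∀ i, f.1.eval (a i) = a (i + 1)}) ≃
        Σ a : Fin k ↪ F, {f : degreeLT F (d + 1) // ∀ i, f.1.eval (a i) = a (i + 1)} :=
      { toFun := fun s => ⟨s.2.1, s.1, s.2.2⟩
        invFun := fun s => ⟨s.2.1, s.1, s.2.2⟩
        left_inv := fun _ => rfl
        right_inv := fun _ => rfl }
    classical
    rw [Nat.card_congr (polynomialCycleEquiv F d k), Nat.card_sigma, Finset.sum_mul]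
    simp only [card_cycles_mul]
    rw [← Nat.card_sigma, Nat.card_congr e, Nat.card_sigma]
    simp only [fun a : Fin k ↪ F => card_degreeLT_eval_eq hk2 a (fun i => a (i + 1))]
    simp [Fintype.card_embedding_eq, hF]
  have hk : (k : ℚ) ≠ 0 := Nat.cast_ne_zero.2 (NeZero.ne k)
  rw [← descPochhammer_eval_eq_prod_range, descPochhammer_eval_eq_descFactorial,
    div_mul_eq_mul_div, eq_div_iff hk]
  exact_mod_cast key
end

section
/- Let q be a prime power and d a positive integer. Define P(q,d) as the total number of cycles (equivalently, connected components of the functional graph) summed over all f ∈ F_q[x] with deg(f) = d, divided by the number of polynomials in F_q[x] of degree exactly d. Then P(q,d) > Σ_{k=1}^{min{d,⌊√q⌋}} (1/k) − 1/4 > ln(min{d,⌊√q⌋} + 1) − 1/4. -/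
open Polynomial

section Counting

variable {F : Type} [Field F]

theorem Polynomial.setOf_degree_eq_natCast (n : ℕ) :
    {f : F[X] | f.degree = (n : WithBot ℕ)} =
      (degreeLT F (n + 1) : Set F[X]) \ (degreeLT F n : Set F[X]) := by
  ext f
  simp only [Set.mem_ofPred_eq, Set.mem_sdiff, SetLike.mem_coe, mem_degreeLT, not_lt]
  constructor
  · intro h
    rw [h]
    exact ⟨by exact_mod_cast Nat.lt_succ_self n, le_rfl⟩
  · rintro ⟨h1, h2⟩
    have h0 : f ≠ 0 := by
      rintro rfl
      simp at h2
    rw [degree_eq_natDegree h0] at h1 h2 ⊢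
    norm_cast at h1 h2 ⊢
    omega

/-- The polynomial `g * ∏ i, (X - a i)` corrected so that it sends `a i` to `a (i + 1)`. -/
noncomputable def cyclePolynomial {k : ℕ} [NeZero k] (a : Fin k ↪ F) (g : F[X]) : F[X] :=
  g * Lagrange.nodal Finset.univ a +
    Lagrange.interpolate Finset.univ a (fun i => a (i + 1))

theorem eval_cyclePolynomial {k : ℕ} [NeZero k] (a : Fin k ↪ F) (g : F[X]) (i : Fin k) :
    (cyclePolynomial a g).eval (a i) = a (i + 1) := by
  rw [cyclePolynomial, eval_add, eval_mul,
    Lagrange.eval_nodal_at_node (Finset.mem_univ i),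
    Lagrange.eval_interpolate_at_node _ a.injective.injOn (Finset.mem_univ i)]
  simp

theorem degree_cyclePolynomial {k d : ℕ} [NeZero k] (hk : k ≤ d) (a : Fin k ↪ F) (g : F[X])
    (hg : g.degree = ((d - k : ℕ) : WithBot ℕ)) :
    (cyclePolynomial a g).degree = (d : WithBot ℕ) := by
  have h1 : (g * Lagrange.nodal Finset.univ a).degree = (d : WithBot ℕ) := by
    rw [degree_mul, hg, Lagrange.degree_nodal, Finset.card_univ, Fintype.card_fin]
    norm_cast
    omega
  rw [cyclePolynomial, degree_add_eq_left_of_degree_lt, h1]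
  rw [h1]
  refine (Lagrange.degree_interpolate_lt _ a.injective.injOn).trans_le ?_
  simpa using hk

theorem cyclePolynomial_injective {k : ℕ} [NeZero k] (a : Fin k ↪ F) :
    Function.Injective (cyclePolynomial a) := by
  intro g g' h
  exact mul_right_cancel₀ Lagrange.nodal_ne_zero (add_right_cancel h)

theorem iterate_apply_of_cyclic {S : Type*} {k : ℕ} [NeZero k] {φ : S → S} {a : Fin k → S}
    (h : ∀ i, φ (a i) = a (i + 1)) (i : Fin k) (j : ℕ) :
    φ^[j] (a i) = a (i + Fin.ofNat k j) := by
  induction j with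
  | zero => simp
  | succ j ih =>
    rw [Function.iterate_succ_apply', ih, h]
    congr 1
    ext
    simp [Fin.val_add, add_assoc]

theorem isCycleSet_map_of_cyclic {S : Type*} {k : ℕ} [NeZero k] {φ : S → S} {a : Fin k ↪ S}
    (h : ∀ i, φ (a i) = a (i + 1)) : IsCycleSet φ (Finset.univ.map a) := by
  refine ⟨by simp [Finset.univ_nonempty], ?_, ?_⟩
  · intro x hx
    obtain ⟨i, -, rfl⟩ := Finset.mem_map.1 hx
    rw [h]
    simp
  · intro x hx y hy
    obtain ⟨i, -, rfl⟩ := Finset.mem_map.1 hx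
    obtain ⟨i', -, rfl⟩ := Finset.mem_map.1 hy
    refine ⟨(i' - i).val, ?_⟩
    rw [iterate_apply_of_cyclic h]
    simp

variable [Fintype F]

theorem Polynomial.finite_degreeLT (n : ℕ) : (degreeLT F n : Set F[X]).Finite := by
  have : Finite (degreeLT F n) := Finite.of_equiv _ (degreeLTEquiv F n).toEquiv.symm
  exact Set.toFinite _

theorem Polynomial.ncard_degreeLT (n : ℕ) :
    (degreeLT F n : Set F[X]).ncard = Fintype.card F ^ n := by
  rw [← Nat.card_coe_set_eq]
  refine (Nat.card_congr (degreeLTEquiv F n).toEquiv).trans ?_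
  simp

theorem Polynomial.finite_setOf_degree_eq (n : ℕ) :
    {f : F[X] | f.degree = (n : WithBot ℕ)}.Finite := by
  rw [setOf_degree_eq_natCast]
  exact (finite_degreeLT _).sdiff

theorem Polynomial.card_degree_eq (n : ℕ) :
    (Nat.card {f : F[X] // f.degree = (n : WithBot ℕ)} : ℝ) =
      (Fintype.card F : ℝ) ^ n * (Fintype.card F - 1) := by
  have h : Nat.card {f : F[X] // f.degree = (n : WithBot ℕ)} =
      Fintype.card F ^ (n + 1) - Fintype.card F ^ n := by
    rw [← ncard_degreeLT, ← ncard_degreeLT,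
      ← Set.ncard_sdiff (degreeLT_mono (Nat.le_succ n)) (finite_degreeLT n),
      ← setOf_degree_eq_natCast, ← Nat.card_coe_set_eq]
    rfl
  rw [h, Nat.cast_sub (Nat.pow_le_pow_right Fintype.card_pos (Nat.le_succ n)), Nat.cast_pow, Nat.cast_pow,
    Nat.succ_eq_add_one]
  ring

variable (F) in
/-- Pairs of a degree-`d` polynomial and a cycle of it. -/
def polynomialCycles (d : ℕ) : Set (F[X] × Finset F) :=
  {p | p.1.degree = (d : WithBot ℕ) ∧ IsCycleSet (fun x => p.1.eval x) p.2}

theorem finite_polynomialCycles (d : ℕ) : (polynomialCycles F d).Finite := by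
  refine Set.Finite.subset ((finite_setOf_degree_eq (F := F) d).prod
    (Set.toFinite (Set.univ : Set (Finset F)))) ?_
  rintro ⟨f, c⟩ h
  exact ⟨h.1, trivial⟩

theorem descFactorial_mul_card_le {k d : ℕ} (hk0 : k ≠ 0) (hk : k ≤ d) :
    (Fintype.card F).descFactorial k *
        Nat.card {f : F[X] // f.degree = ((d - k : ℕ) : WithBot ℕ)} ≤
      ((finite_polynomialCycles (F := F) d).toFinset.filter (fun p => p.2.card = k)).card * k := by
  classical
  have : NeZero k := ⟨hk0⟩
  set T := (finite_polynomialCycles (F := F) d).toFinset.filter (fun p => p.2.card = k)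
  have hcard : (T.sigma fun p => p.2).card = T.card * k := by
    rw [Finset.card_sigma, Finset.sum_const_nat]
    intro p hp
    exact (Finset.mem_filter.1 hp).2
  let G : (Fin k ↪ F) × {f : F[X] // f.degree = ((d - k : ℕ) : WithBot ℕ)} →
      (T.sigma fun p => p.2) := fun x =>
    ⟨⟨(cyclePolynomial x.1 x.2.1, Finset.univ.map x.1), x.1 0⟩, by
      simp only [T, Finset.mem_sigma, Finset.mem_filter, Set.Finite.mem_toFinset]
      exact ⟨⟨⟨degree_cyclePolynomial hk _ _ x.2.2,
        isCycleSet_map_of_cyclic (eval_cyclePolynomial x.1 x.2.1)⟩, by simp⟩, by simp⟩⟩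
  have hG : Function.Injective G := by
    rintro ⟨a, g, hg⟩ ⟨a', g', hg'⟩ h
    simp only [G, Subtype.mk.injEq, Sigma.mk.injEq, Prod.mk.injEq, heq_eq_eq] at h
    obtain ⟨⟨h1, -⟩, h2⟩ := h
    have ha : a = a' := by
      ext i
      have e := iterate_apply_of_cyclic (φ := fun x => (cyclePolynomial a g).eval x)
        (eval_cyclePolynomial a g) 0 i.val
      have e' := iterate_apply_of_cyclic (φ := fun x => (cyclePolynomial a' g').eval x)
        (eval_cyclePolynomial a' g') 0 i.val
      rw [← h1, ← h2, e] at e'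
      simpa using e'
    subst ha
    have := cyclePolynomial_injective a h1
    subst this
    rfl
  have := Nat.card_le_card_of_injective G hG
  rw [Nat.card_prod, Nat.card_eq_fintype_card (α := Fin k ↪ F), Fintype.card_embedding_eq,
    Fintype.card_fin, Nat.card_eq_fintype_card (α := T.sigma _), Fintype.card_coe, hcard] at this
  exact this

end Counting

theorem pow_mul_one_sub_le_descFactorial {q k : ℕ} (hk : k ≤ q) :
    (q : ℝ) ^ k * (1 - k * (k - 1) / (2 * q)) ≤ q.descFactorial k := by
  induction k with
  | zero => simp
  | succ k ih =>
    have ih := ih (by omega)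
    have hq : (0 : ℝ) < q := by exact_mod_cast (by omega : 0 < q)
    have hkq : (k : ℝ) ≤ q := by exact_mod_cast (by omega : k ≤ q)
    rw [Nat.descFactorial_succ, Nat.cast_mul, Nat.cast_sub (by omega)]
    refine le_trans ?_ (mul_le_mul_of_nonneg_left ih (sub_nonneg.2 hkq))
    have hkk : (0 : ℝ) ≤ k * (k - 1) := by
      rcases k with _ | k
      · simp
      · push_cast
        rw [add_sub_cancel_right]
        positivity
    have hid : ((q : ℝ) - k) * (q ^ k * (1 - k * (k - 1) / (2 * q))) -
        q ^ (k + 1) * (1 - ((k + 1 : ℕ) : ℝ) * (((k + 1 : ℕ) : ℝ) - 1) / (2 * q)) =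
        q ^ k * (k * (k * (k - 1)) / (2 * q)) := by
      push_cast
      field_simp
      ring
    have : (0 : ℝ) ≤ q ^ k * (k * (k * (k - 1)) / (2 * q)) := by positivity
    linarith

theorem sum_Icc_inv_sub (m : ℕ) (q : ℝ) :
    ∑ k ∈ Finset.Icc 1 m, ((1 : ℝ) / k - (k - 1) / (2 * q)) =
      ∑ k ∈ Finset.Icc 1 m, (1 : ℝ) / k - m * (m - 1) / (4 * q) := by
  rw [Finset.sum_sub_distrib]
  congr 1
  induction m with
  | zero => simp
  | succ m ih =>
    rw [Finset.sum_Icc_succ_top (by omega), ih]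
    push_cast
    ring

theorem log_add_one_lt_sum_Icc {m : ℕ} (hm : 0 < m) :
    Real.log (m + 1) < ∑ k ∈ Finset.Icc 1 m, (1 : ℝ) / k := by
  have step (n : ℕ) : Real.log ((n + 1 : ℕ) + 1) < Real.log (n + 1) + 1 / (n + 1 : ℕ) := by
    have hn : (0 : ℝ) < n + 1 := by positivity
    have h := Real.log_lt_sub_one_of_pos (x := ((n : ℝ) + 1 + 1) / (n + 1)) (by positivity)
      (by rw [Ne, div_eq_one_iff_eq hn.ne']; linarith)
    rw [Real.log_div (by positivity) hn.ne'] at h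
    have e : ((n : ℝ) + 1 + 1) / (n + 1) - 1 = 1 / (n + 1) := by
      field_simp
      ring
    push_cast
    linarith
  induction m, hm using Nat.le_induction with
  | base => simpa using step 0
  | succ n hn ih =>
    rw [Finset.sum_Icc_succ_top (by omega)]
    linarith [step n]

/-- **Theorem 2.3 (lower bound, harmonic form).** The average number of cycles (equivalently,
connected components of the functional graph) of a degree-`d` polynomial over `F_q` satisfies
`P(q,d) > Σ_{k=1}^{min{d,⌊√q⌋}} 1/k - 1/4 > ln(min{d,⌊√q⌋} + 1) - 1/4`. -/
theorem avg_cycles_of_polynomials_harmonic_lower_bound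
    (q d : ℕ) (F : Type) [Field F] [Fintype F] (hF : Fintype.card F = q)
    (hd : 0 < d)
    (P : ℝ)
    (hP : P = (Nat.card {p : Polynomial F × Finset F //
        p.1.degree = (d : WithBot ℕ) ∧ IsCycleSet (fun x => p.1.eval x) p.2} : ℝ) /
      (Nat.card {f : Polynomial F // f.degree = (d : WithBot ℕ)} : ℝ)) :
    P > (∑ k ∈ Finset.Icc 1 (min d (Nat.sqrt q)), (1 : ℝ) / k) - 1 / 4 ∧
    (∑ k ∈ Finset.Icc 1 (min d (Nat.sqrt q)), (1 : ℝ) / k) - 1 / 4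
      > Real.log (min d (Nat.sqrt q) + 1) - 1 / 4 := by
  subst hF
  set q := Fintype.card F
  set m := min d (Nat.sqrt q) with hm
  have hq1 : 1 < q := Fintype.one_lt_card
  have hm0 : 0 < m := lt_min hd (Nat.sqrt_pos.2 (by omega))
  have hmq : m * m ≤ q :=
    (Nat.mul_le_mul (min_le_right _ _) (min_le_right _ _)).trans (Nat.sqrt_le q)
  refine ⟨?_, ?_⟩
  · have hqR : (1 : ℝ) < q := by exact_mod_cast hq1
    have hq0 : (0 : ℝ) < q := by linarith
    have hN : (0 : ℝ) < (q : ℝ) ^ d * (q - 1) := mul_pos (by positivity) (by linarith)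
    set T := (finite_polynomialCycles (F := F) d).toFinset
    have hTcard : Nat.card {p : Polynomial F × Finset F //
        p.1.degree = (d : WithBot ℕ) ∧ IsCycleSet (fun x => p.1.eval x) p.2} = T.card :=
      Nat.card_eq_card_finite_toFinset (finite_polynomialCycles (F := F) d)
    have hsum : ∑ k ∈ Finset.Icc 1 m, ((T.filter (fun p => p.2.card = k)).card : ℝ) ≤ T.card := by
      rw [← Nat.cast_sum, Finset.sum_card_fiberwise_eq_card_filter]
      exact_mod_cast Finset.card_filter_le _ _
    have hterm : ∀ k ∈ Finset.Icc 1 m, ((1 : ℝ) / k - (k - 1) / (2 * q)) * (q ^ d * (q - 1)) ≤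
        ((T.filter (fun p => p.2.card = k)).card : ℝ) := by
      intro k hk
      obtain ⟨hk1, hkm⟩ := Finset.mem_Icc.1 hk
      have hkd : k ≤ d := hkm.trans (min_le_left _ _)
      have hkq : k ≤ q := hkm.trans ((Nat.le_mul_self m).trans hmq)
      have hk0 : (0 : ℝ) < k := by exact_mod_cast hk1
      have h : (q.descFactorial k : ℝ) * ((q : ℝ) ^ (d - k) * (q - 1)) ≤
          ((T.filter (fun p => p.2.card = k)).card : ℝ) * k := by
        rw [← Polynomial.card_degree_eq]
        exact_mod_cast descFactorial_mul_card_le (F := F) (by omega) hkd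
      refine le_of_mul_le_mul_right (le_trans (le_of_eq ?_) ((mul_le_mul_of_nonneg_right
        (pow_mul_one_sub_le_descFactorial hkq) (mul_nonneg (by positivity)
          (by linarith))).trans h)) hk0
      rw [← Nat.add_sub_cancel' hkd, Nat.add_sub_cancel_left, pow_add]
      field_simp
    have hlow := (Finset.sum_le_sum hterm).trans hsum
    rw [← Finset.sum_mul, sum_Icc_inv_sub, ← le_div_iff₀ hN] at hlow
    rw [hP, hTcard, Polynomial.card_degree_eq]
    refine lt_of_lt_of_le ?_ hlow
    have hmqR : (m : ℝ) * m ≤ q := by exact_mod_cast hmq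
    have hmR : (0 : ℝ) < m := by exact_mod_cast hm0
    have : (m : ℝ) * (m - 1) / (4 * q) < 1 / 4 := by
      rw [div_lt_div_iff₀ (by positivity) (by norm_num)]
      nlinarith
    linarith
  · have h := log_add_one_lt_sum_Icc hm0
    linarith
end

section
/- Let q be a prime power and d a positive integer with d ≥ q−1. Define P(q,d) as the total number of cycles of f acting on F_q, summed over all f ∈ F_q[x] with deg(f) = d, divided by the number of polynomials in F_q[x] of degree exactly d. Then P(q,d) ≤ Σ_{k=1}^{q} (1/k). -/
open Polynomial

namespace IsCycleSet

variable {S : Type*} {φ : S → S} {c c' : Finset S} {x : S}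

lemma iterate_mem_s6 (hc : IsCycleSet φ c) (hx : x ∈ c) (j : ℕ) : φ^[j] x ∈ c := by
  induction j with
  | zero => simpa using hx
  | succ j ih =>
    rw [Function.iterate_succ_apply']
    exact hc.2.1 _ ih

lemma minimalPeriod_pos_s6 (hc : IsCycleSet φ c) (hx : x ∈ c) :
    0 < Function.minimalPeriod φ x := by
  obtain ⟨j, hj⟩ := hc.2.2 _ (hc.2.1 x hx) x hx
  apply Function.minimalPeriod_pos_of_mem_periodicPts
  exact ⟨j + 1, Nat.succ_pos j, by simpa [Function.IsPeriodicPt, Function.IsFixedPt] using hj⟩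

lemma card_eq_minimalPeriod (hc : IsCycleSet φ c) (hx : x ∈ c) :
    c.card = Function.minimalPeriod φ x := by
  symm
  rw [← Finset.card_range (Function.minimalPeriod φ x)]
  refine Finset.card_bij (fun i _ => φ^[i] x) (fun i _ => hc.iterate_mem_s6 hx i) ?_ ?_
  · intro i hi j hj hij
    exact Function.iterate_injOn_Iio_minimalPeriod (by simpa using hi) (by simpa using hj) hij
  · intro y hy
    obtain ⟨j, hj⟩ := hc.2.2 x hx y hy
    refine ⟨j % Function.minimalPeriod φ x, ?_, ?_⟩
    · simpa using Nat.mod_lt _ (hc.minimalPeriod_pos_s6 hx)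
    · rw [Function.iterate_mod_minimalPeriod_eq, hj]

lemma subset_of_mem (hc : IsCycleSet φ c) (hc' : IsCycleSet φ c') (hx : x ∈ c) (hx' : x ∈ c') :
    c ⊆ c' := by
  intro y hy
  obtain ⟨j, rfl⟩ := hc.2.2 x hx y hy
  exact hc'.iterate_mem_s6 hx' j

lemma eq_of_mem (hc : IsCycleSet φ c) (hc' : IsCycleSet φ c') (hx : x ∈ c) (hx' : x ∈ c') :
    c = c' :=
  (hc.subset_of_mem hc' hx hx').antisymm (hc'.subset_of_mem hc hx' hx)

end IsCycleSet

/-- Every cycle contributes `1` to the sum of the inverse minimal periods of its points. -/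
lemma card_isCycleSet_le_sum_inv_minimalPeriod {S : Type*} [Fintype S] (φ : S → S) :
    (Nat.card {c : Finset S // IsCycleSet φ c} : ℝ) ≤
      ∑ x, (1 : ℝ) / Function.minimalPeriod φ x := by
  classical
  have hcard : (Nat.card {c : Finset S // IsCycleSet φ c} : ℝ) =
      ∑ c ∈ Finset.univ.filter (IsCycleSet φ), (1 : ℝ) := by
    rw [Nat.card_eq_fintype_card, Fintype.card_subtype]
    simp
  have hone : ∀ c ∈ Finset.univ.filter (IsCycleSet φ),
      (1 : ℝ) = ∑ x ∈ c, (1 : ℝ) / Function.minimalPeriod φ x := by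
    intro c hc
    have hc : IsCycleSet φ c := by simpa using hc
    rw [Finset.sum_congr rfl fun x hx => by rw [← hc.card_eq_minimalPeriod hx]]
    have : (c.card : ℝ) ≠ 0 := by exact_mod_cast hc.1.card_pos.ne'
    simp [this]
  rw [hcard, Finset.sum_congr rfl hone, ← Finset.sum_biUnion]
  · exact Finset.sum_le_sum_of_subset_of_nonneg (Finset.subset_univ _)
      fun _ _ _ => by positivity
  · intro c hc c' hc' hne
    have hc : IsCycleSet φ c := by simpa using hc
    have hc' : IsCycleSet φ c' := by simpa using hc'
    exact Finset.disjoint_left.2 fun x hx hx' => hne (hc.eq_of_mem hc' hx hx')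

lemma sum_inv_minimalPeriod_eq {S : Type*} [Fintype S] (φ : S → S) :
    ∑ x, (1 : ℝ) / Function.minimalPeriod φ x =
      ∑ k ∈ Finset.Icc 1 (Fintype.card S),
        (Nat.card {x // Function.minimalPeriod φ x = k} : ℝ) * (1 / k) := by
  classical
  have hrange : ∀ x ∈ (Finset.univ : Finset S),
      Function.minimalPeriod φ x ∈ Finset.range (Fintype.card S + 1) := fun x _ =>
    Finset.mem_range.2 (Nat.lt_succ_of_le Function.minimalPeriod_le_card)
  rw [← Finset.sum_fiberwise_of_maps_to hrange]
  refine (Finset.sum_subset_zero_on_sdiff ?_ ?_ ?_).symm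
  · intro k hk
    simp only [Finset.mem_Icc, Finset.mem_range] at hk ⊢
    omega
  · intro k hk
    have hk0 : k = 0 := by
      simp only [Finset.mem_sdiff, Finset.mem_Icc, Finset.mem_range] at hk
      omega
    refine Finset.sum_eq_zero fun x hx => ?_
    rw [(Finset.mem_filter.1 hx).2, hk0]
    simp
  · intro k _
    rw [Finset.sum_congr rfl fun x hx => by rw [(Finset.mem_filter.1 hx).2],
      Nat.card_eq_fintype_card, Fintype.card_subtype]
    simp

lemma Polynomial.finite_degree_eq (F : Type*) [Field F] [Finite F] (d : ℕ) :
    Finite {f : F[X] // f.degree = (d : WithBot ℕ)} := by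
  have : Finite (degreeLT F (d + 1)) := Finite.of_equiv _ (degreeLTEquiv F (d + 1)).toEquiv.symm
  refine Finite.of_injective (β := degreeLT F (d + 1)) (fun f => ⟨f.1, ?_⟩) ?_
  · rw [mem_degreeLT, f.2]
    exact_mod_cast Nat.lt_succ_self d
  · intro f g h
    simpa [Subtype.ext_iff] using h

section Perturbation

variable {F : Type*} [Field F]

/-- The monic polynomial whose roots are the first `n` points of the orbit of `x` under `p`. -/
noncomputable def orbitPoly (p : F[X]) (x : F) (n : ℕ) : F[X] :=
  ∏ i ∈ Finset.range n, (X - C ((fun y => p.eval y)^[i] x))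

lemma degree_orbitPoly (p : F[X]) (x : F) (n : ℕ) : (orbitPoly p x n).degree = n := by
  rw [orbitPoly, degree_prod_of_monic _ _ fun i _ => monic_X_sub_C _]
  simp

lemma eval_orbitPoly_eq_zero (p : F[X]) (x : F) {i n : ℕ} (hi : i < n) :
    (orbitPoly p x n).eval ((fun y => p.eval y)^[i] x) = 0 := by
  rw [orbitPoly, eval_prod]
  exact Finset.prod_eq_zero (Finset.mem_range.2 hi) (by simp)

lemma eval_orbitPoly_ne_zero (p : F[X]) (x : F) {n : ℕ}
    (hn : n < Function.minimalPeriod (fun y => p.eval y) x) :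
    (orbitPoly p x n).eval ((fun y => p.eval y)^[n] x) ≠ 0 := by
  rw [orbitPoly, eval_prod, Finset.prod_ne_zero_iff]
  intro i hi h
  have hi := Finset.mem_range.1 hi
  simp only [eval_sub, eval_X, eval_C, sub_eq_zero] at h
  have := Function.iterate_injOn_Iio_minimalPeriod (f := fun y => p.eval y) (x := x)
    (Set.mem_Iio.2 hn) (Set.mem_Iio.2 (hi.trans hn)) h
  omega

lemma iterate_perturb (p : F[X]) (x s : F) {i n : ℕ} (hi : i ≤ n) :
    (fun y => (p + C s * orbitPoly p x n).eval y)^[i] x = (fun y => p.eval y)^[i] x := by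
  induction i with
  | zero => rfl
  | succ i ih =>
    rw [Function.iterate_succ_apply', Function.iterate_succ_apply', ih (by omega)]
    simp [eval_orbitPoly_eq_zero p x (show i < n by omega)]

lemma perturb_injective {p p' : F[X]} {x s s' : F} {n : ℕ}
    (hp : Function.minimalPeriod (fun y => p.eval y) x = n + 1)
    (hp' : Function.minimalPeriod (fun y => p'.eval y) x = n + 1)
    (h : p + C s * orbitPoly p x n = p' + C s' * orbitPoly p' x n) : s = s' ∧ p = p' := by
  have hiter : ∀ i ≤ n, (fun y => p.eval y)^[i] x = (fun y => p'.eval y)^[i] x := by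
    intro i hi
    rw [← iterate_perturb p x s hi, h, iterate_perturb p' x s' hi]
  have horb : orbitPoly p x n = orbitPoly p' x n :=
    Finset.prod_congr rfl fun i hi => by rw [hiter i (Finset.mem_range.1 hi).le]
  have hlast : ∀ g : F[X], Function.minimalPeriod (fun y => g.eval y) x = n + 1 →
      g.eval ((fun y => g.eval y)^[n] x) = x := by
    intro g hg
    have := Function.iterate_minimalPeriod (f := fun y => g.eval y) (x := x)
    rwa [hg, Function.iterate_succ_apply'] at this
  have hs : s = s' := by
    have h1 := congrArg (eval ((fun y => p.eval y)^[n] x)) h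
    have h2 := hlast p' hp'
    rw [← hiter n le_rfl] at h2
    rw [← horb] at h1
    simp only [eval_add, eval_mul, eval_C, hlast p hp, h2] at h1
    exact mul_right_cancel₀ (eval_orbitPoly_ne_zero p x (by omega)) (add_left_cancel h1)
  subst hs
  rw [horb] at h
  exact ⟨rfl, add_right_cancel h⟩

end Perturbation

lemma card_mul_card_minimalPeriod_le_of_le {F : Type*} [Field F] [Finite F] {d k : ℕ}
    (hk : 0 < k) (hkd : k ≤ d) (x : F) :
    Nat.card F * Nat.card {f : {f : F[X] // f.degree = (d : WithBot ℕ)} //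
        Function.minimalPeriod (fun y => f.1.eval y) x = k} ≤
      Nat.card {f : F[X] // f.degree = (d : WithBot ℕ)} := by
  obtain ⟨n, rfl⟩ : ∃ n, k = n + 1 := ⟨k - 1, by omega⟩
  have := finite_degree_eq F d
  rw [← Nat.card_prod]
  refine Nat.card_le_card_of_injective
    (fun a => ⟨a.2.1.1 + C a.1 * orbitPoly a.2.1.1 x n, ?_⟩) ?_
  · rw [degree_add_eq_left_of_degree_lt, a.2.1.2]
    rw [a.2.1.2]
    rw [← smul_eq_C_mul]
    refine (degree_smul_le _ _).trans_lt ?_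
    rw [degree_orbitPoly]
    exact_mod_cast hkd
  · rintro ⟨s, ⟨p, hp⟩, hpk⟩ ⟨s', ⟨p', hp'⟩, hpk'⟩ h
    obtain ⟨rfl, rfl⟩ := perturb_injective hpk hpk' (congrArg Subtype.val h)
    rfl

/-- A polynomial of degree `q - 1` over a field with `q ≥ 3` elements is not a permutation. -/
lemma not_bijective_eval_of_degree_eq_card_sub_one {F : Type*} [Field F] [Fintype F]
    (hq : 2 < Fintype.card F) {p : F[X]} (hp : p.degree = ((Fintype.card F - 1 : ℕ) : WithBot ℕ)) :
    ¬ Function.Bijective (fun y => p.eval y) := by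
  intro hbij
  have hsum : ∑ y, p.eval y = 0 := by
    rw [hbij.sum_comp (fun y : F => y)]
    simpa using FiniteField.sum_pow_lt_card_sub_one F 1 (by omega)
  have hnat : p.natDegree = Fintype.card F - 1 := natDegree_eq_of_degree_eq_some hp
  have htop : ∑ y : F, y ^ (Fintype.card F - 1) = -1 := by
    classical
    rw [Finset.sum_eq_sum_sdiff_singleton_add (Finset.mem_univ (0 : F)),
      zero_pow (by omega), add_zero,
      Finset.sum_congr rfl fun y hy => FiniteField.pow_card_sub_one_eq_one y (by simpa using hy)]
    simp [Finset.card_sdiff, Nat.cast_sub Fintype.card_pos]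
  simp only [eval_eq_sum_range, hnat] at hsum
  rw [Finset.sum_comm, Finset.sum_range_succ, Finset.sum_eq_zero, ← Finset.mul_sum, htop] at hsum
  · have : p.coeff (Fintype.card F - 1) = 0 := by simpa using hsum
    rw [← hnat, coeff_natDegree, leadingCoeff_eq_zero] at this
    simp [this] at hp
  · intro i hi
    rw [← Finset.mul_sum, FiniteField.sum_pow_lt_card_sub_one F i (Finset.mem_range.1 hi), mul_zero]

lemma bijective_of_minimalPeriod_eq_card {S : Type*} [Fintype S] {φ : S → S} {x : S}
    (h : Function.minimalPeriod φ x = Fintype.card S) : Function.Bijective φ := by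
  have hinj : Function.Injective (fun i : Fin (Fintype.card S) => φ^[i] x) := fun i j hij =>
    Fin.ext (Function.iterate_injOn_Iio_minimalPeriod (by simp [h]) (by simp [h]) hij)
  have hsurj := ((Fintype.bijective_iff_injective_and_card _).2 ⟨hinj, by simp⟩).2
  refine Function.Surjective.bijective_of_finite fun y => ?_
  obtain ⟨i, rfl⟩ := hsurj y
  refine ⟨φ^[i + Fintype.card S - 1] x, ?_⟩
  have hsucc : (i + Fintype.card S - 1).succ = i + Function.minimalPeriod φ x := by omega
  rw [← Function.iterate_succ_apply' φ, hsucc, Function.iterate_add_minimalPeriod_eq]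

lemma card_mul_card_minimalPeriod_le_of_card_eq_two {F : Type*} [Field F] [Fintype F] {d k : ℕ}
    (hF : Fintype.card F = 2) (hk : 1 < k) (hd : 0 < d) (x : F) :
    Nat.card F * Nat.card {f : {f : F[X] // f.degree = (d : WithBot ℕ)} //
        Function.minimalPeriod (fun y => f.1.eval y) x = k} ≤
      Nat.card {f : F[X] // f.degree = (d : WithBot ℕ)} := by
  classical
  have := finite_degree_eq F d
  have hmoved : ∀ g : F[X], Function.minimalPeriod (fun y => g.eval y) x = k → g.eval x ≠ x := by
    intro g hg hfix
    have := Function.minimalPeriod_eq_one_iff_isFixedPt.2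
      (show Function.IsFixedPt (fun y => g.eval y) x from hfix)
    omega
  rw [← Nat.card_prod]
  refine Nat.card_le_card_of_injective (fun a => ⟨a.2.1.1 + C a.1, ?_⟩) ?_
  · rw [degree_add_C, a.2.1.2]
    rw [a.2.1.2]
    exact_mod_cast hd
  · rintro ⟨s, ⟨p, hp⟩, hpk⟩ ⟨s', ⟨p', hp'⟩, hpk'⟩ h
    have h : p + C s = p' + C s' := congrArg Subtype.val h
    have heval : p.eval x = p'.eval x := by
      by_contra hne
      have hcard := Finset.card_le_univ ({p.eval x, p'.eval x, x} : Finset F)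
      rw [Finset.card_eq_three.2 ⟨_, _, _, hne, hmoved p hpk, hmoved p' hpk', rfl⟩] at hcard
      omega
    have hs := congrArg (eval x) h
    simp only [eval_add, eval_C, heval] at hs
    obtain rfl := add_left_cancel hs
    obtain rfl := add_right_cancel h
    rfl

/-- At most a proportion `1 / q` of the polynomials of degree `d ≥ q - 1` have a given point as
a point of minimal period `k`. -/
lemma card_mul_card_minimalPeriod_le {F : Type*} [Field F] [Fintype F] {d k : ℕ}
    (hd : 0 < d) (hdq : Fintype.card F - 1 ≤ d) (hk : 0 < k) (hkq : k ≤ Fintype.card F) (x : F) :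
    Nat.card F * Nat.card {f : {f : F[X] // f.degree = (d : WithBot ℕ)} //
        Function.minimalPeriod (fun y => f.1.eval y) x = k} ≤
      Nat.card {f : F[X] // f.degree = (d : WithBot ℕ)} := by
  rcases le_or_gt k d with hkd | hkd
  · exact card_mul_card_minimalPeriod_le_of_le hk hkd x
  have hkF : k = Fintype.card F := by omega
  rcases eq_or_ne (Fintype.card F) 2 with h2 | h2
  · exact card_mul_card_minimalPeriod_le_of_card_eq_two h2 (by omega) hd x
  have : IsEmpty {f : {f : F[X] // f.degree = (d : WithBot ℕ)} //
      Function.minimalPeriod (fun y => f.1.eval y) x = k} := by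
    refine ⟨fun ⟨⟨f, hf⟩, hfk⟩ => ?_⟩
    have hdF : d = Fintype.card F - 1 := by omega
    exact not_bijective_eval_of_degree_eq_card_sub_one (by omega) (hdF ▸ hf)
      (bijective_of_minimalPeriod_eq_card (hfk.trans hkF))
  simp

/-- On average, a polynomial of degree `d ≥ q - 1` has at most one point of minimal period `k`. -/
lemma sum_card_minimalPeriod_le {F : Type*} [Field F] [Fintype F] {d k : ℕ}
    [Fintype {f : F[X] // f.degree = (d : WithBot ℕ)}]
    (hd : 0 < d) (hdq : Fintype.card F - 1 ≤ d) (hk : 0 < k) (hkq : k ≤ Fintype.card F) :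
    ∑ f : {f : F[X] // f.degree = (d : WithBot ℕ)},
        Nat.card {x // Function.minimalPeriod (fun y => f.1.eval y) x = k} ≤
      Nat.card {f : F[X] // f.degree = (d : WithBot ℕ)} := by
  classical
  have hswap : ∑ f : {f : F[X] // f.degree = (d : WithBot ℕ)},
        Nat.card {x // Function.minimalPeriod (fun y => f.1.eval y) x = k} =
      ∑ x : F, Nat.card {f : {f : F[X] // f.degree = (d : WithBot ℕ)} //
        Function.minimalPeriod (fun y => f.1.eval y) x = k} := by
    simp only [Nat.card_eq_fintype_card, Fintype.card_subtype, Finset.card_filter]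
    exact Finset.sum_comm
  rw [hswap]
  refine Nat.le_of_mul_le_mul_left ?_ (Nat.card_pos (α := F))
  rw [Finset.mul_sum]
  refine (Finset.sum_le_card_nsmul _ _ _ fun x _ =>
    card_mul_card_minimalPeriod_le hd hdq hk hkq x).trans_eq ?_
  simp

/-- **Corollary 2.4 (upper bound, large degree).** If `d ≥ q - 1`, then the average number of
cycles of a degree-`d` polynomial over `F_q` is at most `Σ_{k=1}^{q} 1/k`. -/
theorem avg_cycles_of_polynomials_upper_bound_large_degree
    (q d : ℕ) (F : Type) [Field F] [Fintype F] (hF : Fintype.card F = q)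
    (hd : 0 < d) (hdq : q - 1 ≤ d) :
    (Nat.card {p : Polynomial F × Finset F //
        p.1.degree = (d : WithBot ℕ) ∧ IsCycleSet (fun x => p.1.eval x) p.2} : ℝ) /
      (Nat.card {f : Polynomial F // f.degree = (d : WithBot ℕ)} : ℝ)
      ≤ ∑ k ∈ Finset.Icc 1 q, (1 : ℝ) / k := by
  have := finite_degree_eq F d
  have := Fintype.ofFinite {f : F[X] // f.degree = (d : WithBot ℕ)}
  have hcard : Nat.card {p : Polynomial F × Finset F //
      p.1.degree = (d : WithBot ℕ) ∧ IsCycleSet (fun x => p.1.eval x) p.2} =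
      ∑ f : {f : F[X] // f.degree = (d : WithBot ℕ)},
        Nat.card {c : Finset F // IsCycleSet (fun x => f.1.eval x) c} := by
    rw [← Nat.card_sigma]
    exact Nat.card_congr
      { toFun := fun p => ⟨⟨p.1.1, p.2.1⟩, ⟨p.1.2, p.2.2⟩⟩
        invFun := fun p => ⟨⟨p.1.1, p.2.1⟩, ⟨p.1.2, p.2.2⟩⟩
        left_inv := fun _ => rfl
        right_inv := fun _ => rfl }
  refine div_le_of_le_mul₀ (by positivity) (by positivity) ?_
  rw [hcard, Nat.cast_sum]
  calc ∑ f : {f : F[X] // f.degree = (d : WithBot ℕ)},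
        (Nat.card {c : Finset F // IsCycleSet (fun x => f.1.eval x) c} : ℝ)
      ≤ ∑ f : {f : F[X] // f.degree = (d : WithBot ℕ)}, ∑ k ∈ Finset.Icc 1 q,
          (Nat.card {x // Function.minimalPeriod (fun y => f.1.eval y) x = k} : ℝ) * (1 / k) := by
        refine Finset.sum_le_sum fun f _ => ?_
        subst hF
        rw [← sum_inv_minimalPeriod_eq]
        exact card_isCycleSet_le_sum_inv_minimalPeriod _
    _ = ∑ k ∈ Finset.Icc 1 q, ((∑ f : {f : F[X] // f.degree = (d : WithBot ℕ)},
          Nat.card {x // Function.minimalPeriod (fun y => f.1.eval y) x = k} : ℕ) : ℝ) *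
            (1 / k) := by
        rw [Finset.sum_comm]
        simp only [Nat.cast_sum, Finset.sum_mul]
    _ ≤ ∑ k ∈ Finset.Icc 1 q,
          (Nat.card {f : F[X] // f.degree = (d : WithBot ℕ)} : ℝ) * (1 / k) := by
        refine Finset.sum_le_sum fun k hk => ?_
        rw [Finset.mem_Icc] at hk
        gcongr
        exact sum_card_minimalPeriod_le hd (hF ▸ hdq) (by omega) (hF ▸ hk.2)
    _ = (∑ k ∈ Finset.Icc 1 q, (1 : ℝ) / k) *
          Nat.card {f : F[X] // f.degree = (d : WithBot ℕ)} := by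
        rw [← Finset.mul_sum, mul_comm]
end

section
/- Let m and t be positive integers and let S be a finite set with |S| = mt. The number of functions f : S → S such that every element of S has either 0 or exactly m preimages under f equals C(mt, t) · (mt)! / (m!)^t, where C(mt,t) is the binomial coefficient. -/
/-- Ordering each fiber of a function `f : α → β` with prescribed fiber sizes `c` amounts to
choosing a bijection `α ≃ Σ v, Fin (c v)`. -/
def sigmaFiberEquivFin {α β : Type*} (c : β → ℕ) :
    (Σ f : α → β, ∀ v, {u // f u = v} ≃ Fin (c v)) ≃ (α ≃ Σ v, Fin (c v)) where
  toFun p := (Equiv.sigmaFiberEquiv p.1).symm.trans (Equiv.sigmaCongrRight p.2)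
  invFun e := ⟨fun u => (e u).1, fun v =>
    (e.subtypeEquiv fun _ => Iff.rfl).trans (Equiv.sigmaSubtype v)⟩
  left_inv := by
    rintro ⟨f, g⟩
    refine Sigma.ext rfl (heq_of_eq ?_)
    funext v
    ext ⟨u, rfl⟩
    rfl
  right_inv e := by
    ext1 u
    rfl

/-- The number of functions with prescribed fiber sizes is a multinomial coefficient. -/
theorem card_fiber_card_eq_mul_prod_factorial {α β : Type*} [Fintype α] [Fintype β]
    (c : β → ℕ) (hc : ∑ v, c v = Fintype.card α) :
    Nat.card {f : α → β // ∀ v, Nat.card {u // f u = v} = c v} * ∏ v, (c v).factorial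
      = (Fintype.card α).factorial := by
  classical
  have hfib (f : α → β) : Nat.card (∀ v, {u // f u = v} ≃ Fin (c v))
      = if ∀ v, Nat.card {u // f u = v} = c v then ∏ v, (c v).factorial else 0 := by
    split_ifs with h
    · rw [Nat.card_pi]
      refine Finset.prod_congr rfl fun v _ => ?_
      have e : {u // f u = v} ≃ Fin (c v) := Finite.equivFinOfCardEq (h v)
      rw [Nat.card_eq_fintype_card, Fintype.card_equiv e, ← Nat.card_eq_fintype_card, h v]
    · have : IsEmpty (∀ v, {u // f u = v} ≃ Fin (c v)) :=
        ⟨fun g => h fun v => by simpa using Nat.card_congr (g v)⟩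
      simp
  have e : α ≃ Σ v, Fin (c v) := Fintype.equivOfCardEq (by simp [hc])
  have key := Nat.card_congr (sigmaFiberEquivFin (α := α) c)
  rw [Nat.card_sigma, Nat.card_eq_fintype_card (α := α ≃ _), Fintype.card_equiv e] at key
  rw [← key, Finset.sum_congr rfl fun f _ => hfib f, ← Finset.sum_filter, Finset.sum_const,
    smul_eq_mul, Nat.card_eq_fintype_card, Fintype.card_subtype]

/-- All fibers of `f` have size `0` or `m`, and `T` is the range of `f`, exactly when the fibers
over `T` have size `m` and the other ones are empty. -/
theorem fiber_card_eq_ite_iff {α β : Type*} [Fintype α] [DecidableEq β] {m : ℕ}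
    (hm : 0 < m) (f : α → β) (T : Finset β) :
    ((∀ v, Nat.card {u // f u = v} = 0 ∨ Nat.card {u // f u = v} = m) ∧
        Finset.univ.image f = T) ↔
      ∀ v, Nat.card {u // f u = v} = if v ∈ T then m else 0 := by
  have hmem (v : β) : v ∈ Finset.univ.image f ↔ Nat.card {u // f u = v} ≠ 0 := by
    rw [← Nat.pos_iff_ne_zero, Finite.card_pos_iff, nonempty_subtype]
    simp
  constructor
  · rintro ⟨h, rfl⟩ v
    split_ifs with hv <;> rw [hmem] at hv
    · exact (h v).resolve_left hv
    · exact not_not.1 hv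
  · intro h
    refine ⟨fun v => ?_, ?_⟩
    · rw [h v]
      split_ifs <;> simp
    · ext v
      rw [hmem, h v]
      split_ifs with hv <;> simp [hv, hm.ne']

/-- If every fiber of `f` has size `0` or `m`, then the domain of `f` has `m` elements for each
element of the range. -/
theorem mul_card_image_eq_card {α β : Type*} [Fintype α] [Fintype β] [DecidableEq β] {m : ℕ}
    (hm : 0 < m) (f : α → β)
    (hf : ∀ v, Nat.card {u // f u = v} = 0 ∨ Nat.card {u // f u = v} = m) :
    m * (Finset.univ.image f).card = Fintype.card α := by
  have h := (fiber_card_eq_ite_iff hm f _).1 ⟨hf, rfl⟩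
  rw [← Nat.card_eq_fintype_card, ← Nat.card_congr (Equiv.sigmaFiberEquiv f), Nat.card_sigma,
    Finset.sum_congr rfl fun v _ => h v]
  rw [Finset.sum_ite_mem, Finset.univ_inter, Finset.sum_const, smul_eq_mul, mul_comm]


/-- The number of functions `f : S → S` on a set of size `m⬝t` in which every point has either
`0` or exactly `m` preimages is `C(mt, t) ⬝ (mt)! / (m!)^t`. -/
theorem count_m_ary_functional_graphs
    (m t : ℕ) (hm : 0 < m) (ht : 0 < t)
    (S : Type) [Fintype S] (hS : Fintype.card S = m * t) :
    (Nat.card {f : S → S //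
        ∀ v : S, Nat.card {u : S // f u = v} = 0 ∨ Nat.card {u : S // f u = v} = m} : ℚ)
      = ((m * t).choose t : ℚ) * (m * t).factorial / (m.factorial : ℚ) ^ t := by
  classical
  have hcard : Nat.card {f : S → S //
        ∀ v : S, Nat.card {u : S // f u = v} = 0 ∨ Nat.card {u : S // f u = v} = m}
      = ∑ T ∈ Finset.univ.powersetCard t, Nat.card {f : S → S //
          ∀ v, Nat.card {u // f u = v} = if v ∈ T then m else 0} := by
    rw [Nat.card_eq_fintype_card, Fintype.card_subtype,
      Finset.card_eq_sum_card_fiberwise (f := fun f : S → S => Finset.univ.image f)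
        (t := Finset.univ.powersetCard t)]
    · refine Finset.sum_congr rfl fun T _ => ?_
      rw [Nat.card_eq_fintype_card, Fintype.card_subtype, Finset.filter_filter]
      simp only [fiber_card_eq_ite_iff hm]
    · intro f hf
      have hf' := mul_card_image_eq_card hm f (by simpa using hf)
      simpa using Nat.eq_of_mul_eq_mul_left hm (hf'.trans hS)
  have hT : ∀ T ∈ (Finset.univ : Finset S).powersetCard t, Nat.card {f : S → S //
      ∀ v, Nat.card {u // f u = v} = if v ∈ T then m else 0} * m.factorial ^ t
        = (m * t).factorial := by
    intro T hT
    have hT' : T.card = t := (Finset.mem_powersetCard.1 hT).2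
    have h := card_fiber_card_eq_mul_prod_factorial (α := S) (fun v => if v ∈ T then m else 0)
      (by simp [Finset.sum_ite_mem, hT', hS, mul_comm])
    simpa [apply_ite Nat.factorial, Finset.prod_ite_mem, hT', hS] using h
  rw [eq_div_iff (by positivity), hcard]
  have hsum := Finset.sum_congr rfl hT
  rw [← Finset.sum_mul, Finset.sum_const, Finset.card_powersetCard, Finset.card_univ, hS,
    smul_eq_mul] at hsum
  exact_mod_cast hsum
end

section
/- Let m and t be positive integers, let S be a finite set with |S| = mt, and let 1 ≤ k ≤ t. The total number of pairs (f, α), where f : S → S is a function such that every element of S has either 0 or exactly m preimages under f, and α ∈ S is a point of exact period k of f (i.e., k is the least positive integer with f^{∘k}(α) = α), equals C(mt−k, t−k) · (mt)! / ((m−1)!)^k / (m!)^{t−k}. -/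
open Finset

/-- A bijection onto a disjoint union of finite intervals is a map with the corresponding fibre
sizes together with an enumeration of each fibre. -/
def equivSigmaFinEquiv {A B : Type*} (c : B → ℕ) :
    (A ≃ Σ b, Fin (c b)) ≃ Σ g : A → B, ∀ b, {a // g a = b} ≃ Fin (c b) where
  toFun e := ⟨fun a => (e a).1, fun b =>
    (e.subtypeEquiv (fun _ => Iff.rfl)).trans (Equiv.sigmaSubtype b)⟩
  invFun p := (Equiv.sigmaFiberEquiv p.1).symm.trans (Equiv.sigmaCongrRight p.2)
  left_inv e := Equiv.ext fun _ => rfl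
  right_inv := by
    rintro ⟨g, h⟩
    refine Sigma.ext rfl (heq_of_eq ?_)
    funext b
    ext ⟨a, rfl⟩
    rfl

theorem card_filter_fiber_card_mul_prod_factorial {A B : Type*} [Fintype A] [Fintype B]
    [DecidableEq A] [DecidableEq B] (c : B → ℕ) (hc : ∑ b, c b = Fintype.card A) :
    #{g : A → B | ∀ b, #{a | g a = b} = c b} * ∏ b, (c b).factorial =
      (Fintype.card A).factorial := by
  have hA : Fintype.card A = Fintype.card (Σ b, Fin (c b)) := by simp [hc]
  rw [← Fintype.card_equiv (Fintype.equivOfCardEq hA), Fintype.card_congr (equivSigmaFinEquiv c),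
    Fintype.card_sigma, ← sum_filter_add_sum_filter_not univ
      (fun g : A → B => ∀ b, #{a | g a = b} = c b)]
  rw [sum_eq_zero (s := filter (fun g : A → B => ¬ _) _), add_zero, sum_const_nat]
  · intro g hg
    rw [mem_filter] at hg
    rw [Fintype.card_pi]
    refine prod_congr rfl fun b _ => ?_
    have h : Fintype.card {a // g a = b} = c b := by rw [Fintype.card_subtype, hg.2]
    rw [Fintype.card_equiv (Fintype.equivFinOfCardEq h), h]
  · intro g hg
    rw [mem_filter] at hg
    refine Fintype.card_eq_zero_iff.mpr ⟨fun e => hg.2 fun b => ?_⟩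
    rw [← Fintype.card_subtype, Fintype.card_congr (e b), Fintype.card_fin]

/-- Functions with prescribed values on `R` and prescribed fibre sizes correspond to functions on
the complement of `R` with the fibre sizes reduced accordingly. -/
theorem card_filter_eqOn_fiber_card {S : Type*} [Fintype S] [DecidableEq S] (R : Finset S)
    (g₀ : S → S) (c : S → ℕ) :
    #{f : S → S | (∀ b, #{a | f a = b} = c b + #{a ∈ R | g₀ a = b}) ∧ ∀ a ∈ R, f a = g₀ a} =
      #{g : {a // a ∉ R} → S | ∀ b, #{a | g a = b} = c b} := by
  have key (f : S → S) (hf : ∀ a ∈ R, f a = g₀ a) (b : S) :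
      #{a | f a = b} = #{a : {a // a ∉ R} | f a = b} + #{a ∈ R | g₀ a = b} := by
    rw [add_comm, ← card_filter_add_card_filter_not (s := {a | f a = b}) (· ∈ R)]
    congr 1
    · congr 1
      ext a
      simp only [mem_filter, mem_univ, true_and]
      refine ⟨fun h => ⟨h.2, hf a h.2 ▸ h.1⟩, fun h => ⟨(hf a h.1).trans h.2, h.1⟩⟩
    · rw [← card_map (Function.Embedding.subtype (fun a => a ∉ R))]
      congr 1
      ext a
      simp [and_comm]
  refine card_bij' (fun f _ a => f a) (fun g _ a => if h : a ∈ R then g₀ a else g ⟨a, h⟩)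
    ?_ ?_ ?_ ?_
  · intro f hf
    simp only [mem_filter, mem_univ, true_and] at hf ⊢
    intro b
    have := hf.1 b
    rw [key f hf.2] at this
    omega
  · intro g hg
    simp only [mem_filter, mem_univ, true_and] at hg ⊢
    have h2 : ∀ a ∈ R, (if h : a ∈ R then g₀ a else g ⟨a, h⟩) = g₀ a := fun a ha => by simp [ha]
    refine ⟨fun b => ?_, h2⟩
    rw [key _ h2, ← hg b]
    congr 3
    ext a
    simp [a.2]
  · intro f hf
    simp only [mem_filter, mem_univ, true_and] at hf
    ext a
    by_cases h : a ∈ R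
    · simp [h, hf.2 a h]
    · simp [h]
  · intro g _
    ext a
    simp [a.2]

/-- The `m`-ary functional graphs extending a given injective map of a set `R` to itself. -/
theorem card_filter_mary_extension {S : Type*} [Fintype S] [DecidableEq S] {m t : ℕ} (hm : 0 < m)
    (hS : Fintype.card S = m * t) (R : Finset S) (g₀ : S → S) (hR : R.image g₀ = R) :
    #{f : S → S | (∀ b, #{a | f a = b} = 0 ∨ #{a | f a = b} = m) ∧ ∀ a ∈ R, f a = g₀ a} *
        ((m - 1).factorial ^ #R * m.factorial ^ (t - #R)) =
      #{I ∈ powersetCard t univ | R ⊆ I} * (m * t - #R).factorial := by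
  have hinj : Set.InjOn g₀ R := card_image_iff.mp (by rw [hR])
  have hfib (b : S) : #{a ∈ R | g₀ a = b} = if b ∈ R then 1 else 0 := by
    split_ifs with hb
    · obtain ⟨a, ha, rfl⟩ := mem_image.mp (hR.symm ▸ hb : b ∈ R.image g₀)
      rw [card_eq_one]
      refine ⟨a, ?_⟩
      ext x
      simp only [mem_filter, mem_singleton]
      exact ⟨fun h => hinj h.1 ha h.2, by rintro rfl; exact ⟨ha, rfl⟩⟩
    · rw [card_eq_zero, filter_eq_empty_iff]
      rintro a ha rfl
      exact hb (hR ▸ mem_image_of_mem g₀ ha)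
  have hpos (f : S → S) (b : S) : #{a | f a = b} = 0 ↔ b ∉ univ.image f := by
    simp [filter_eq_empty_iff]
  rw [card_eq_sum_card_fiberwise (f := fun f : S → S => univ.image f)
    (t := {I ∈ powersetCard t univ | R ⊆ I}), sum_mul, sum_const_nat]
  · intro I hI
    simp only [mem_filter, mem_powersetCard_univ] at hI
    obtain ⟨hI, hRI⟩ := hI
    have hset : {f ∈ ({f : S → S | (∀ b, #{a | f a = b} = 0 ∨ #{a | f a = b} = m) ∧
          ∀ a ∈ R, f a = g₀ a} : Finset (S → S)) | univ.image f = I} =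
        ({f : S → S | (∀ b, #{a | f a = b} = (if b ∈ R then m - 1 else if b ∈ I then m else 0) +
          #{a ∈ R | g₀ a = b}) ∧ ∀ a ∈ R, f a = g₀ a} : Finset (S → S)) := by
      ext f
      have hc (b : S) : (if b ∈ R then m - 1 else if b ∈ I then m else 0) +
          #{a ∈ R | g₀ a = b} = if b ∈ I then m else 0 := by
        rw [hfib]
        by_cases hb : b ∈ R
        · simp only [hb, hRI hb, if_true]
          omega
        · simp [hb]
      simp only [hc, mem_filter, mem_univ, true_and]
      constructor
      · rintro ⟨⟨h1, h2⟩, rfl⟩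
        refine ⟨fun b => ?_, h2⟩
        have := hpos f b
        have := h1 b
        split_ifs <;> tauto
      · rintro ⟨h1, h2⟩
        refine ⟨⟨fun b => ?_, h2⟩, ?_⟩
        · rw [h1]
          split_ifs <;> simp
        · ext b
          have := hpos f b
          rw [h1] at this
          split_ifs at this with hb
          · have := hm.ne'
            tauto
          · tauto
    have hcard : Fintype.card {a // a ∉ R} = m * t - #R := by
      rw [Fintype.card_subtype_compl, hS, Fintype.card_coe]
    have hRt : #R ≤ t := hI ▸ card_le_card hRI
    have hprod : ∏ b, (if b ∈ R then m - 1 else if b ∈ I then m else 0).factorial =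
        (m - 1).factorial ^ #R * m.factorial ^ (t - #R) := by
      rw [← hI, ← card_sdiff_of_subset hRI, ← prod_const, ← prod_const,
        ← prod_subset (subset_univ I), ← prod_sdiff hRI, mul_comm]
      · congr 1
        · exact prod_congr rfl fun b hb => by simp [hb]
        · refine prod_congr rfl fun b hb => ?_
          rw [mem_sdiff] at hb
          simp [hb]
      · intro b _ hb
        simp [hb, mt (@hRI b) hb]
    have hsum : ∑ b, (if b ∈ R then m - 1 else if b ∈ I then m else 0) =
        m * t - #R := by
      rw [← hI, ← sum_subset (subset_univ I), ← sum_sdiff hRI,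
        sum_congr (s₁ := R) rfl (g := fun _ => m - 1) (fun b hb => by simp [hb]),
        sum_congr (s₁ := I \ R) rfl (g := fun _ => m) (fun b hb => by
          rw [mem_sdiff] at hb
          simp [hb]), sum_const, sum_const, card_sdiff_of_subset hRI]
      · obtain ⟨d, hd⟩ := Nat.exists_eq_add_of_le (card_le_card hRI)
        obtain ⟨n, rfl⟩ := Nat.exists_eq_add_of_le' hm
        rw [hd, Nat.add_sub_cancel_left, Nat.add_sub_cancel]
        apply Nat.eq_sub_of_add_eq
        simp only [smul_eq_mul]
        ring
      · intro b _ hb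
        simp [hb, mt (@hRI b) hb]
    rw [hset, card_filter_eqOn_fiber_card, ← hprod,
      card_filter_fiber_card_mul_prod_factorial _ (by rw [hsum, hcard]), hcard]
  · intro f hf
    simp only [coe_filter, mem_univ, true_and, Set.mem_ofPred_eq, mem_powersetCard_univ] at hf ⊢
    obtain ⟨h1, h2⟩ := hf
    refine ⟨?_, fun b hb => ?_⟩
    · have h := card_eq_sum_card_image f univ
      rw [sum_const_nat (m := m), card_univ, hS, mul_comm] at h
      · exact (Nat.eq_of_mul_eq_mul_right hm h).symm
      · intro b hb
        exact (h1 b).resolve_left fun h => (hpos f b).mp h hb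
    · rw [← hR] at hb
      obtain ⟨a, ha, rfl⟩ := mem_image.mp hb
      exact mem_image.mpr ⟨a, mem_univ a, h2 a ha⟩

theorem card_filter_mary_extension_cycle {S : Type*} [Fintype S] [DecidableEq S] {m t k : ℕ}
    (hm : 0 < m) (hkt : k ≤ t) (hS : Fintype.card S = m * t) (v : Fin k ↪ S)
    (σ : Equiv.Perm (Fin k)) :
    #{f : S → S | (∀ b, #{a | f a = b} = 0 ∨ #{a | f a = b} = m) ∧ ∀ i, f (v i) = v (σ i)} *
        ((m - 1).factorial ^ k * m.factorial ^ (t - k)) =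
      (m * t - k).choose (t - k) * (m * t - k).factorial := by
  have hex (i : Fin k) : Function.extend v (v ∘ σ) id (v i) = v (σ i) :=
    v.injective.extend_apply _ _ i
  have hR : (univ.map v).image (Function.extend v (v ∘ σ) id) = univ.map v := by
    ext x
    simp only [mem_image, mem_map, mem_univ, true_and, exists_exists_eq_and, hex]
    exact (σ.surjective.exists (p := fun i => v i = x)).symm
  have h := card_filter_mary_extension hm hS _ _ hR
  rw [card_filter_powersetCard_subset _ _ _ (subset_univ _) (by simpa using hkt)] at h
  simpa [hex, hS] using h

theorem iterate_apply_zero_of_finRotate {S : Type*} {n : ℕ} {f : S → S} {v : Fin (n + 1) → S}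
    (h : ∀ i, f (v i) = v (finRotate _ i)) (i : Fin (n + 1)) : f^[i] (v 0) = v i := by
  induction i using Fin.induction with
  | zero => rfl
  | succ i ih =>
    rw [Fin.val_castSucc] at ih
    rw [Fin.val_succ, Function.iterate_succ_apply', ih, h, finRotate_apply, Fin.coeSucc_eq_succ]

theorem injective_iterate_of_forall_ne {S : Type*} {k : ℕ} {f : S → S} {x : S}
    (hk : f^[k] x = x) (hlt : ∀ j : ℕ, 0 < j → j < k → f^[j] x ≠ x) :
    Function.Injective fun i : Fin k => f^[i] x := by
  have key (i j : ℕ) (hij : i < j) (hj : j < k) : f^[i] x ≠ f^[j] x := by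
    intro h
    refine hlt (k - j + i) (by omega) (by omega) ?_
    rw [Function.iterate_add_apply, h, ← Function.iterate_add_apply, Nat.sub_add_cancel hj.le, hk]
  intro i j h
  by_contra hne
  rcases Nat.lt_or_gt_of_ne (Fin.val_ne_of_ne hne) with h' | h'
  · exact key _ _ h' j.2 h
  · exact key _ _ h' i.2 h.symm

/-- A function together with a point of exact period `n + 1` corresponds to a function together
with an enumerated cycle. -/
def exactPeriodEquivCycle {S : Type*} (P : (S → S) → Prop) (n : ℕ) :
    {p : (S → S) × S // P p.1 ∧ p.1^[n + 1] p.2 = p.2 ∧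
      ∀ j : ℕ, 0 < j → j < n + 1 → p.1^[j] p.2 ≠ p.2} ≃
    {q : (Fin (n + 1) ↪ S) × (S → S) // P q.2 ∧ ∀ i, q.2 (q.1 i) = q.1 (finRotate _ i)} where
  toFun p := ⟨(⟨_, injective_iterate_of_forall_ne p.2.2.1 p.2.2.2⟩, p.1.1), p.2.1, fun i => by
    change p.1.1 (p.1.1^[i] p.1.2) = p.1.1^[(finRotate _ i : Fin (n + 1))] p.1.2
    rw [← Function.iterate_succ_apply' p.1.1, finRotate_apply, Fin.val_add_one]
    split_ifs with h
    · subst h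
      exact p.2.2.1
    · rfl⟩
  invFun q := ⟨(q.1.2, q.1.1 0), q.2.1, by
    have key := iterate_apply_zero_of_finRotate q.2.2
    refine ⟨?_, fun j hj0 hj h => ?_⟩
    · have h := q.2.2 (Fin.last n)
      rwa [← key, finRotate_last, Fin.val_last, ← Function.iterate_succ_apply' q.1.2] at h
    · exact hj0.ne' (congrArg Fin.val (q.1.1.injective ((key ⟨j, hj⟩).symm.trans h)))⟩
  left_inv p := rfl
  right_inv q := Subtype.ext <| Prod.ext
    (DFunLike.ext _ _ fun i => iterate_apply_zero_of_finRotate q.2.2 i) rfl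

/-- The number of pairs `(f, α)`, where `f : S → S` is a function on a set of size `m⬝t` in which
every point has either `0` or exactly `m` preimages and `α` is a point of exact period `k` of
`f`, is `C(mt-k, t-k) ⬝ (mt)! / ((m-1)!)^k / (m!)^(t-k)`, for `1 ≤ k ≤ t`. -/
theorem count_exact_period_points_of_m_ary_functional_graphs
    (m t k : ℕ) (hm : 0 < m) (ht : 0 < t) (hk1 : 1 ≤ k) (hkt : k ≤ t)
    (S : Type) [Fintype S] (hS : Fintype.card S = m * t) :
    (Nat.card {p : (S → S) × S //
        (∀ v : S, Nat.card {u : S // p.1 u = v} = 0 ∨ Nat.card {u : S // p.1 u = v} = m) ∧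
        p.1^[k] p.2 = p.2 ∧ ∀ j : ℕ, 0 < j → j < k → p.1^[j] p.2 ≠ p.2} : ℚ)
      = ((m * t - k).choose (t - k) : ℚ) * (m * t).factorial
          / ((m - 1).factorial : ℚ) ^ k / (m.factorial : ℚ) ^ (t - k) := by
  classical
  obtain ⟨n, rfl⟩ := Nat.exists_eq_add_of_le' hk1
  rw [div_div, eq_div_iff (by positivity)]
  norm_cast
  have hk : n + 1 ≤ m * t := hkt.trans (Nat.le_mul_of_pos_left t hm)
  rw [Nat.card_congr (exactPeriodEquivCycle
      (fun f => ∀ v : S, Nat.card {u : S // f u = v} = 0 ∨ Nat.card {u : S // f u = v} = m) n),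
    Nat.card_congr (Equiv.subtypeProdEquivSigmaSubtype
      (fun (v : Fin (n + 1) ↪ S) (f : S → S) =>
        (∀ v : S, Nat.card {u : S // f u = v} = 0 ∨ Nat.card {u : S // f u = v} = m) ∧
          ∀ i, f (v i) = v (finRotate _ i))),
    Nat.card_sigma]
  simp only [Nat.card_eq_fintype_card, Fintype.card_subtype]
  rw [sum_mul, sum_const_nat fun v _ => card_filter_mary_extension_cycle hm hkt hS v _, card_univ,
    Fintype.card_embedding_eq, hS, Fintype.card_fin, ← Nat.factorial_mul_descFactorial hk]
  ring
end

section
/- Let t be a positive integer and let S be a finite set with |S| = 2t. The average number of periodic points of f, taken over all functions f : S → S such that every element of S has either 0 or exactly 2 preimages under f (a 'quadratic' functional graph), equals −1 + 4^t / C(2t, t). Moreover, as t → ∞ this quantity is asymptotic to √(π/2) · √(2t), i.e., the ratio of the average to √(π t) tends to 1. -/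
open Filter

/-- The average number of periodic points over all "quadratic" functional graphs on `S`
(functions `S → S` in which every point has either `0` or `2` preimages): the number of pairs
`(f, α)` with `f` quadratic and `α` periodic, divided by the number of quadratic `f`. -/
noncomputable def quadAvgPeriodic (S : Type) [Fintype S] : ℝ :=
  (Nat.card {p : (S → S) × S //
      (∀ v : S, Nat.card {u : S // p.1 u = v} = 0 ∨ Nat.card {u : S // p.1 u = v} = 2) ∧
      ∃ n : ℕ, 0 < n ∧ p.1^[n] p.2 = p.2} : ℝ) /
    (Nat.card {f : S → S //
      ∀ v : S, Nat.card {u : S // f u = v} = 0 ∨ Nat.card {u : S // f u = v} = 2} : ℝ)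

open Finset in
theorem sum_range_choose_div_two_pow (t : ℕ) :
    ∑ j ∈ range (t + 1), ((t + j).choose t : ℝ) / 2 ^ j = 2 ^ t := by
  induction t with
  | zero => simp
  | succ t ih =>
    have pascal : ∀ j : ℕ, ((t + 1 + (j + 1)).choose (t + 1) : ℝ) / 2 ^ (j + 1) =
        ((t + (j + 1)).choose t : ℝ) / 2 ^ (j + 1) +
          ((t + 1 + j).choose (t + 1) : ℝ) / 2 ^ j / 2 := by
      intro j
      rw [show t + 1 + (j + 1) = (t + 1 + j) + 1 by ring, Nat.choose_succ_succ,
        show t + (j + 1) = t + 1 + j by ring]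
      push_cast
      field_simp
      ring
    have central : ((t + 1 + (t + 1)).choose (t + 1) : ℝ) = 2 * ((t + (t + 1)).choose t : ℝ) := by
      have h : (t + 1 + t).choose (t + 1) = (t + 1 + t).choose t :=
        Nat.choose_symm_of_eq_add (by ring)
      rw [show t + 1 + (t + 1) = (t + 1 + t) + 1 by ring, Nat.choose_succ_succ, h,
        show t + (t + 1) = t + 1 + t by ring]
      push_cast
      ring
    set B := ∑ j ∈ range (t + 1 + 1), ((t + 1 + j).choose (t + 1) : ℝ) / 2 ^ j with hB
    have hleft := sum_range_succ' (fun j => ((t + j).choose t : ℝ) / 2 ^ j) (t + 1)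
    rw [sum_range_succ, ih] at hleft
    have hright := hB
    rw [sum_range_succ, central] at hright
    rw [sum_range_succ', sum_congr rfl fun j _ => pascal j, sum_add_distrib, ← sum_div] at hB
    simp only [add_zero, Nat.choose_self, Nat.cast_one, pow_zero, div_one] at hB hleft
    rw [mul_div_assoc] at hright
    rw [pow_succ]
    linarith

open Finset in
theorem sum_two_pow_mul_descFactorial_div (t : ℕ) :
    ∑ k ∈ range (2 * t), (2 : ℝ) ^ (k + 1) * t.descFactorial (k + 1) /
      (2 * t).descFactorial (k + 1) = -1 + 4 ^ t / ((2 * t).choose t : ℝ) := by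
  have hC : ((2 * t).choose t : ℝ) ≠ 0 := by
    exact_mod_cast (Nat.choose_pos (by omega)).ne'
  have term : ∀ k ∈ range (t + 1), (2 : ℝ) ^ k * t.descFactorial k / (2 * t).descFactorial k =
      2 ^ t / ((2 * t).choose t : ℝ) *
        (((t + (t + 1 - 1 - k)).choose t : ℝ) / 2 ^ (t + 1 - 1 - k)) := by
    intro k hk
    obtain ⟨j, rfl⟩ := Nat.exists_eq_add_of_le (Nat.lt_succ_iff.1 (mem_range.1 hk))
    simp only [Nat.add_sub_cancel, Nat.add_sub_cancel_left]
    have h1 := Nat.factorial_mul_descFactorial (n := k + j) (k := k) (by omega)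
    have h2 := Nat.factorial_mul_descFactorial (n := 2 * (k + j)) (k := k) (by omega)
    have h3 := Nat.choose_mul_factorial_mul_factorial (n := 2 * (k + j)) (k := k + j) (by omega)
    have h4 := Nat.choose_mul_factorial_mul_factorial (n := k + j + j) (k := k + j) (by omega)
    rw [show k + j - k = j by omega] at h1
    rw [show 2 * (k + j) - k = k + j + j by omega] at h2
    rw [show 2 * (k + j) - (k + j) = k + j by omega] at h3
    rw [show k + j + j - (k + j) = j by omega] at h4
    have hd : ((2 * (k + j)).descFactorial k : ℝ) ≠ 0 := by
      exact_mod_cast (Nat.descFactorial_pos.2 (by omega)).ne'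
    have hj : (j.factorial : ℝ) ≠ 0 := by positivity
    have hs : ((k + j).factorial : ℝ) ≠ 0 := by positivity
    rw [div_mul_div_comm, div_eq_div_iff hd (by positivity)]
    have key : (k + j).descFactorial k * (2 * (k + j)).choose (k + j) =
        (k + j + j).choose (k + j) * (2 * (k + j)).descFactorial k := by
      have : 0 < (k + j).factorial * j.factorial := by positivity
      apply Nat.eq_of_mul_eq_mul_right this
      calc _ = (2 * (k + j)).choose (k + j) * (k + j).factorial *
            (j.factorial * (k + j).descFactorial k) := by ring
        _ = (k + j + j).choose (k + j) * (k + j).factorial * j.factorial *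
            (2 * (k + j)).descFactorial k := by rw [h1, h3, h4, h2]
        _ = _ := by ring
    have key' : ((k + j).descFactorial k : ℝ) * (2 * (k + j)).choose (k + j) =
        (k + j + j).choose (k + j) * (2 * (k + j)).descFactorial k := by exact_mod_cast key
    rw [pow_add]
    linear_combination (2 ^ k * 2 ^ j) * key'
  have full := sum_congr rfl term
  rw [← mul_sum, sum_range_reflect (fun j => ((t + j).choose t : ℝ) / 2 ^ j) (t + 1),
    sum_range_choose_div_two_pow, sum_range_succ'] at full
  have tail : ∑ k ∈ range (2 * t), (2 : ℝ) ^ (k + 1) * t.descFactorial (k + 1) /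
      (2 * t).descFactorial (k + 1) = ∑ k ∈ range t, (2 : ℝ) ^ (k + 1) *
        t.descFactorial (k + 1) / (2 * t).descFactorial (k + 1) := by
    symm
    apply sum_subset (range_subset_range.2 (by omega))
    intro k _ hk
    rw [Nat.descFactorial_of_lt (by simp at hk; omega)]
    simp
  rw [tail]
  have h4 : (4 : ℝ) ^ t = 2 ^ t * 2 ^ t := by rw [← mul_pow]; norm_num
  rw [h4]
  simp only [pow_zero, Nat.descFactorial_zero, Nat.cast_one] at full
  linarith [mul_div_right_comm ((2 : ℝ) ^ t) (2 ^ t) ((2 * t).choose t : ℝ)]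

theorem four_pow_div_choose_eq_sqrt (n : ℕ) :
    4 ^ n / ((2 * n).choose n : ℝ) = Real.sqrt (Real.Wallis.W n * (2 * n + 1)) := by
  symm
  rw [Real.Wallis.W_eq_factorial_ratio, Real.sqrt_eq_iff_mul_self_eq (by positivity) (by positivity)]
  have h := Nat.choose_mul_factorial_mul_factorial (n := 2 * n) (k := n) (by omega)
  rw [show 2 * n - n = n by omega] at h
  have hC : ((2 * n).choose n : ℝ) ≠ 0 := by
    exact_mod_cast (Nat.choose_pos (by omega)).ne'
  have h' : ((2 * n).factorial : ℝ) = (2 * n).choose n * n.factorial * n.factorial := by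
    exact_mod_cast h.symm
  rw [h', pow_mul]
  have : (n.factorial : ℝ) ≠ 0 := by positivity
  have : (2 * n + 1 : ℝ) ≠ 0 := by positivity
  field_simp
  rw [← pow_mul (4 : ℝ), mul_comm n 2, pow_mul (4 : ℝ)]
  norm_num

theorem tendsto_four_pow_div_choose :
    Tendsto (fun n : ℕ => (-1 + 4 ^ n / ((2 * n).choose n : ℝ)) / Real.sqrt (Real.pi * n))
      atTop (nhds 1) := by
  have hinv : Tendsto (fun n : ℕ => (n : ℝ)⁻¹) atTop (nhds 0) :=
    tendsto_inv_atTop_zero.comp tendsto_natCast_atTop_atTop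
  have hsqrt : Tendsto (fun n : ℕ => Real.sqrt (Real.pi * n)) atTop atTop :=
    Real.tendsto_sqrt_atTop.comp
      (tendsto_natCast_atTop_atTop.const_mul_atTop Real.pi_pos)
  have hone : Tendsto (fun n : ℕ => (-1 : ℝ) / Real.sqrt (Real.pi * n)) atTop (nhds 0) :=
    tendsto_const_nhds.div_atTop hsqrt
  have hmain : Tendsto (fun n : ℕ => Real.sqrt (Real.Wallis.W n * ((2 + (n : ℝ)⁻¹) / Real.pi)))
      atTop (nhds 1) := by
    have h := (Real.Wallis.tendsto_W_nhds_pi_div_two.mul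
      ((hinv.const_add 2).div_const Real.pi)).sqrt
    convert h using 2
    rw [add_zero, div_mul_div_comm, mul_comm, div_self (by positivity), Real.sqrt_one]
  have h := hone.add hmain
  rw [zero_add] at h
  refine h.congr' ?_
  filter_upwards [eventually_gt_atTop 0] with n hn
  have hn' : (n : ℝ) ≠ 0 := by positivity
  have := Real.pi_ne_zero
  rw [add_div (-1 : ℝ), four_pow_div_choose_eq_sqrt, ← Real.sqrt_div' _ (by positivity)]
  congr 2
  field_simp

/-- A self-map all of whose points have either `0` or `2` preimages. -/
def IsQuadraticMap {S : Type} (f : S → S) : Prop :=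
  ∀ v : S, Nat.card {u : S // f u = v} = 0 ∨ Nat.card {u : S // f u = v} = 2

namespace IsQuadraticMap

variable {S : Type} {f : S → S}

theorem card_fiber_apply [Finite S] (hf : IsQuadraticMap f) (u : S) :
    Nat.card {w : S // f w = f u} = 2 := by
  refine (hf (f u)).resolve_left ?_
  have : Nonempty {w : S // f w = f u} := ⟨⟨u, rfl⟩⟩
  exact Nat.card_pos.ne'

theorem card_eq_two_mul_card_range [Finite S] (hf : IsQuadraticMap f) :
    Nat.card S = 2 * Nat.card (Set.range f) := by
  have := Fintype.ofFinite (Set.range f)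
  rw [← Nat.card_congr (Equiv.sigmaFiberEquiv (Set.rangeFactorization f)), Nat.card_sigma,
    Finset.sum_congr rfl (g := fun _ => 2)]
  · simp [mul_comm]
  · rintro ⟨_, u, rfl⟩ -
    rw [← hf.card_fiber_apply u]
    exact Nat.card_congr (Equiv.subtypeEquivRight fun w => by
      simp [Subtype.ext_iff, Set.rangeFactorization_coe])

theorem card_injective_comp [Finite S] (hf : IsQuadraticMap f) {t : ℕ}
    (hS : Nat.card S = 2 * t) (k : ℕ) :
    Nat.card {x : Fin k → S // Function.Injective (f ∘ x)} = 2 ^ k * t.descFactorial k := by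
  have hrange : Nat.card (Set.range f) = t := by
    have := hf.card_eq_two_mul_card_range
    omega
  have := Fintype.ofFinite (Set.range f)
  let e : {x : Fin k → S // Function.Injective (f ∘ x)} ≃
      Σ y : Fin k ↪ Set.range f, ∀ i, {u : S // f u = y i} :=
    { toFun := fun x => ⟨⟨fun i => ⟨f (x.1 i), x.1 i, rfl⟩, fun i j h =>
        x.2 (congrArg Subtype.val h)⟩, fun i => ⟨x.1 i, rfl⟩⟩
      invFun := fun p => ⟨fun i => p.2 i, fun i j h => p.1.injective (Subtype.ext (by
        simpa only [Function.comp_apply, (p.2 _).2] using h))⟩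
      left_inv := fun x => rfl
      right_inv := by
        rintro ⟨y, x⟩
        have hy : y = ⟨fun i => ⟨f (x i), x i, rfl⟩, fun i j h => y.injective (Subtype.ext (by
            simpa only [(x _).2] using congrArg Subtype.val h))⟩ := by
          ext i
          exact (x i).2.symm
        refine Sigma.ext hy.symm ?_
        refine Function.hfunext rfl ?_
        rintro i _ ⟨⟩
        rw [Subtype.heq_iff_coe_eq]
        intro u
        exact ((x i).2 ▸ Iff.rfl) }
  rw [Nat.card_congr e, Nat.card_sigma, Finset.sum_congr rfl (g := fun _ => 2 ^ k)]
  · rw [Finset.sum_const, Finset.card_univ, Fintype.card_embedding_eq, smul_eq_mul, mul_comm,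
      Fintype.card_fin, ← Nat.card_eq_fintype_card, hrange]
  · intro y _
    rw [Nat.card_pi, Finset.prod_congr rfl (g := fun _ => 2)]
    · simp
    · intro i _
      obtain ⟨u, hu⟩ := (y i).2
      rw [← hu, hf.card_fiber_apply]

theorem comp_perm (hf : IsQuadraticMap f) (π : Equiv.Perm S) : IsQuadraticMap (f ∘ π) := by
  intro v
  have h : Nat.card {u : S // (f ∘ π) u = v} = Nat.card {u : S // f u = v} :=
    Nat.card_congr (π.subtypeEquiv fun u => Iff.rfl)
  rw [h]
  exact hf v

theorem exists_of_card_eq {t : ℕ} (hS : Nat.card S = 2 * t) [Finite S] :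
    ∃ f : S → S, IsQuadraticMap f := by
  have : Nat.card S = Nat.card (Fin t × Bool) := by simp [hS, mul_comm]
  obtain ⟨e⟩ := Finite.card_eq.1 this
  refine ⟨fun s => e.symm ((e s).1, true), fun v => ?_⟩
  obtain ⟨⟨i, b⟩, rfl⟩ := e.symm.surjective v
  cases b with
  | false =>
    left
    have : IsEmpty {u : S // e.symm ((e u).1, true) = e.symm (i, false)} :=
      ⟨fun u => by simpa using u.2⟩
    exact Nat.card_of_isEmpty
  | true =>
    right
    let g : {u : S // e.symm ((e u).1, true) = e.symm (i, true)} ≃ Bool :=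
      { toFun := fun u => (e u).2
        invFun := fun b => ⟨e.symm (i, b), by simp⟩
        left_inv := fun u => by
          have hu : (e u).1 = i := by simpa using u.2
          ext
          simp [← hu]
        right_inv := fun b => by simp }
    rw [Nat.card_congr g]
    simp

end IsQuadraticMap

/-- Pairs of a quadratic map `f` and an injective tuple on whose entries `f` acts
by the permutation `σ` of the indices. -/
abbrev QuadraticTuple (S : Type) {k : ℕ} (σ : Equiv.Perm (Fin k)) : Type :=
  {p : (S → S) × (Fin k ↪ S) // IsQuadraticMap p.1 ∧ ∀ i, p.1 (p.2 i) = p.2 (σ i)}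

theorem card_quadraticTuple (S : Type) [Finite S] {t : ℕ} (hS : Nat.card S = 2 * t) {k : ℕ}
    (σ : Equiv.Perm (Fin k)) :
    (2 * t).descFactorial k * Nat.card (QuadraticTuple S σ) =
      Nat.card {f : S → S // IsQuadraticMap f} * (2 ^ k * t.descFactorial k) := by
  have := Fintype.ofFinite S
  have := Fintype.ofFinite {f : S → S // IsQuadraticMap f}
  choose π hπ using fun x y : Fin k ↪ S =>
    Equiv.Perm.exists_extending_pair x y x.injective y.injective
  have hπ' : ∀ (x y : Fin k ↪ S) i, (π x y).symm (y i) = x i := fun x y i => by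
    rw [Equiv.symm_apply_eq, hπ]
  let shift : ∀ f : S → S, {x : Fin k → S // Function.Injective (f ∘ x)} → (Fin k ↪ S) :=
    fun f x => ⟨fun i => f (x.1 (σ.symm i)), x.2.comp σ.symm.injective⟩
  let base : ∀ f : S → S, {x : Fin k → S // Function.Injective (f ∘ x)} → (Fin k ↪ S) :=
    fun f x => ⟨x.1, x.2.of_comp⟩
  let e : (Fin k ↪ S) × QuadraticTuple S σ ≃
      Σ f : {f : S → S // IsQuadraticMap f}, {x : Fin k → S // Function.Injective (f.1 ∘ x)} :=
    { toFun := fun p => ⟨⟨p.2.1.1 ∘ π p.1 p.2.1.2, p.2.2.1.comp_perm _⟩, p.1, by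
        have : (p.2.1.1 ∘ π p.1 p.2.1.2) ∘ p.1 = p.2.1.2 ∘ σ := by
          funext i
          simp [hπ, p.2.2.2]
        rw [this]
        exact p.2.1.2.injective.comp σ.injective⟩
      invFun := fun q => ⟨base q.1 q.2,
        ⟨q.1.1 ∘ (π (base q.1 q.2) (shift q.1 q.2)).symm, shift q.1 q.2⟩,
        q.1.2.comp_perm _, fun i => by
          simp only [Function.comp_apply, hπ']
          simp [base, shift]⟩
      left_inv := by
        rintro ⟨x, ⟨f, y⟩, hf, hy⟩
        have hy' : ∀ i, f (y i) = y (σ i) := hy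
        have h : ∀ h, shift (f ∘ π x y) ⟨x, h⟩ = y := fun h => by
          ext i
          simp [shift, hπ, hy']
        have h' : ∀ h, base (f ∘ π x y) ⟨x, h⟩ = x := fun h => rfl
        simp only [h, h', Prod.mk.injEq, Subtype.mk.injEq, true_and, and_true]
        funext s
        simp
      right_inv := by
        rintro ⟨⟨f, hf⟩, x, hx⟩
        have : ∀ τ : Equiv.Perm S, (f ∘ τ.symm) ∘ τ = f := fun τ => by
          funext s
          simp
        exact Sigma.subtype_ext (Subtype.ext (this _)) rfl }
  have h := Nat.card_congr e
  rw [Nat.card_prod, Nat.card_sigma,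
    Finset.sum_congr rfl (fun f _ => f.2.card_injective_comp hS k), Finset.sum_const,
    Finset.card_univ, smul_eq_mul, Nat.card_eq_fintype_card (α := Fin k ↪ S),
    Fintype.card_embedding_eq, Fintype.card_fin, ← Nat.card_eq_fintype_card, hS] at h
  rw [h, Nat.card_eq_fintype_card]

section Cycle

open Fin.NatCast

variable {S : Type} {f : S → S} {k : ℕ}

theorem iterate_apply_zero_of_apply_eq_add_one {x : Fin (k + 1) → S}
    (h : ∀ i, f (x i) = x (i + 1)) (n : ℕ) : f^[n] (x 0) = x (n : Fin (k + 1)) := by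
  induction n with
  | zero => simp
  | succ n ih => rw [Function.iterate_succ_apply', ih, h, Nat.cast_succ]

theorem minimalPeriod_of_apply_eq_add_one {x : Fin (k + 1) → S} (hx : Function.Injective x)
    (h : ∀ i, f (x i) = x (i + 1)) : Function.minimalPeriod f (x 0) = k + 1 := by
  have key : ∀ n, Function.IsPeriodicPt f n (x 0) ↔ k + 1 ∣ n := fun n => by
    rw [Function.IsPeriodicPt, Function.IsFixedPt, iterate_apply_zero_of_apply_eq_add_one h,
      hx.eq_iff, Fin.natCast_eq_zero]
  exact Nat.dvd_antisymm ((key _).2 dvd_rfl).minimalPeriod_dvd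
    ((key _).1 (Function.isPeriodicPt_minimalPeriod f _))

/-- Quadratic maps with a point of minimal period `k + 1` correspond to quadratic maps with a
parametrised cycle of length `k + 1`. -/
def quadraticTupleEquiv (S : Type) (k : ℕ) :
    {p : (S → S) × S // IsQuadraticMap p.1 ∧ Function.minimalPeriod p.1 p.2 = k + 1} ≃
      QuadraticTuple S (Equiv.addRight (1 : Fin (k + 1))) where
  toFun p := ⟨(p.1.1, ⟨fun i => p.1.1^[(i : ℕ)] p.1.2, fun i j h => Fin.ext (by
      have hinj := Function.iterate_injOn_Iio_minimalPeriod (f := p.1.1) (x := p.1.2)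
      rw [p.2.2] at hinj
      exact hinj i.2 j.2 h)⟩), p.2.1, fun i => by
      have h := Function.iterate_mod_minimalPeriod_eq (f := p.1.1) (x := p.1.2) (n := i + 1)
      rw [p.2.2, Function.iterate_succ_apply'] at h
      change p.1.1 (p.1.1^[(i : ℕ)] p.1.2) = p.1.1^[((i + 1 : Fin (k + 1)) : ℕ)] p.1.2
      rw [Fin.val_add, Fin.val_one', Nat.add_mod_mod, h]⟩
  invFun q := ⟨(q.1.1, q.1.2 0), q.2.1, minimalPeriod_of_apply_eq_add_one q.1.2.injective q.2.2⟩
  left_inv p := rfl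
  right_inv q := by
    refine Subtype.ext (Prod.ext rfl ?_)
    ext i
    exact (iterate_apply_zero_of_apply_eq_add_one q.2.2 i).trans (by simp)

end Cycle

theorem card_quadratic_periodic_eq_sum (S : Type) [Fintype S] :
    Nat.card {p : (S → S) × S // IsQuadraticMap p.1 ∧ ∃ n : ℕ, 0 < n ∧ p.1^[n] p.2 = p.2} =
      ∑ k ∈ Finset.range (Fintype.card S),
        Nat.card (QuadraticTuple S (Equiv.addRight (1 : Fin (k + 1)))) := by
  let e : {p : (S → S) × S // IsQuadraticMap p.1 ∧ ∃ n : ℕ, 0 < n ∧ p.1^[n] p.2 = p.2} ≃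
      Σ k : Fin (Fintype.card S),
        {p : (S → S) × S // IsQuadraticMap p.1 ∧ Function.minimalPeriod p.1 p.2 = k + 1} :=
    { toFun := fun p =>
        have h : 0 < Function.minimalPeriod p.1.1 p.1.2 :=
          Function.minimalPeriod_pos_iff_mem_periodicPts.2 p.2.2
        ⟨⟨Function.minimalPeriod p.1.1 p.1.2 - 1, by
          have := Function.minimalPeriod_le_card (f := p.1.1) (x := p.1.2)
          omega⟩, p.1, p.2.1, by simp only; omega⟩
      invFun := fun q => ⟨q.2.1, q.2.2.1, q.1 + 1, by omega, by
        have h := Function.isPeriodicPt_minimalPeriod q.2.1.1 q.2.1.2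
        rwa [q.2.2.2] at h⟩
      left_inv := fun p => rfl
      right_inv := by
        rintro ⟨⟨k, hk⟩, p, hp, hper⟩
        exact Sigma.subtype_ext (Fin.ext (by simp [hper])) rfl }
  rw [Nat.card_congr e, Nat.card_sigma, Finset.sum_range]
  exact Finset.sum_congr rfl fun k _ => Nat.card_congr (quadraticTupleEquiv S k)

/-- **Quadratic graphs behave like random graphs.** On a set with `2t` elements, the average
number of periodic points of a quadratic functional graph equals `-1 + 4^t / C(2t,t)`, and as
`t → ∞` this quantity is asymptotic to `√(π/2)⬝√(2t) = √(π t)`. -/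
theorem avg_periodic_points_of_quadratic_graphs
    (t : ℕ) (ht : 0 < t) (S : Type) [Fintype S] (hS : Fintype.card S = 2 * t) :
    quadAvgPeriodic S = -1 + 4 ^ t / ((2 * t).choose t : ℝ) ∧
    Tendsto (fun n : ℕ => (-1 + 4 ^ n / ((2 * n).choose n : ℝ)) / Real.sqrt (Real.pi * n))
      atTop (nhds 1) := by
  refine ⟨?_, tendsto_four_pow_div_choose⟩
  have hcard : Nat.card S = 2 * t := by rw [Nat.card_eq_fintype_card, hS]
  obtain ⟨f₀, hf₀⟩ := IsQuadraticMap.exists_of_card_eq hcard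
  have : Nonempty {f : S → S // IsQuadraticMap f} := ⟨⟨f₀, hf₀⟩⟩
  have hpos : (Nat.card {f : S → S // IsQuadraticMap f} : ℝ) ≠ 0 :=
    Nat.cast_ne_zero.2 Nat.card_pos.ne'
  have hnum := card_quadratic_periodic_eq_sum S
  change (Nat.card {p : (S → S) × S //
    IsQuadraticMap p.1 ∧ ∃ n : ℕ, 0 < n ∧ p.1^[n] p.2 = p.2} : ℝ) /
      Nat.card {f : S → S // IsQuadraticMap f} = _
  rw [hnum, hS, ← sum_two_pow_mul_descFactorial_div, Nat.cast_sum, Finset.sum_div]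
  refine Finset.sum_congr rfl fun k hk => ?_
  have hk' : k < 2 * t := Finset.mem_range.1 hk
  have hd : ((2 * t).descFactorial (k + 1) : ℝ) ≠ 0 :=
    Nat.cast_ne_zero.2 (Nat.descFactorial_pos.2 (by omega)).ne'
  have h := card_quadraticTuple S hcard (Equiv.addRight (1 : Fin (k + 1)))
  rw [div_eq_div_iff hpos hd]
  have h' := congrArg (Nat.cast (R := ℝ)) h
  push_cast at h'
  linear_combination h'
end

section
/- Let q be a prime power. Choose distinct β_1, …, β_m ∈ F_q and arbitrary γ_1, …, γ_m ∈ F_q. Let G_0 ∈ F_q[x] be monic of degree j_0 that is either constant (i.e., G_0 = 1) or irreducible, let G_1 ∈ F_q[x] be monic of degree j_1, let G = G_0·G_1 and j = j_0 + j_1. Let S(G_0, G_1) be the set of monic f ∈ F_q[x] with deg(f) = j, G_0 ∣ f, and f(β_i) = γ_i·G(β_i) for all i ∈ {1, …, m}. Then: (1) if j < m, then |S(G_0,G_1)| ≤ 1; (2) if j_1 < m ≤ j and G_0 ≠ (x − β_i) for every i, then |S(G_0,G_1)| ≤ 1; (3) if j ≥ m and either G_0 = 1 or G_0 = (x − β_i)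 for some i, then |S(G_0,G_1)| = q^{j−m}; (4) if j_1 ≥ m and G_0 ≠ (x − β_i) for every i, then |S(G_0,G_1)| = q^{j_1−m}. -/
open Polynomial

section MonicInterpolation

variable {F ι : Type*} [Field F] [Fintype ι]

/-- The type of monic polynomials of degree `n` taking the value `δ i` at `β i` for all `i`. -/
abbrev MonicInterpolant (n : ℕ) (β δ : ι → F) : Type _ :=
  {f : F[X] // f.Monic ∧ f.natDegree = n ∧ ∀ i, f.eval (β i) = δ i}

theorem nodal_dvd_of_eval_eq_zero {β : ι → F} (hβ : Function.Injective β) {f : F[X]}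
    (hf : ∀ i, f.eval (β i) = 0) : Lagrange.nodal Finset.univ β ∣ f :=
  Finset.prod_dvd_of_coprime ((pairwise_coprime_X_sub_C hβ).set_pairwise _)
    fun i _ => dvd_iff_isRoot.2 (hf i)

theorem degree_sub_lt_of_monic {f g : F[X]} {n : ℕ} (hf : f.Monic) (hg : g.Monic)
    (hfn : f.natDegree = n) (hgn : g.natDegree = n) : (f - g).degree < n := by
  have hfd := degree_eq_natDegree hf.ne_zero
  have hgd := degree_eq_natDegree hg.ne_zero
  rw [hfn] at hfd
  rw [hgn] at hgd
  exact hfd ▸ degree_sub_lt_left (hfd.trans hgd.symm) hf.ne_zero (by rw [hf, hg])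

theorem subsingleton_monicInterpolant {n : ℕ} {β : ι → F} (hβ : Function.Injective β)
    (δ : ι → F) (hn : n < Fintype.card ι) : Subsingleton (MonicInterpolant n β δ) := by
  refine ⟨fun ⟨f, hf, hfn, hfe⟩ ⟨g, hg, hgn, hge⟩ => Subtype.ext ?_⟩
  refine Polynomial.eq_of_degree_sub_lt_of_eval_index_eq Finset.univ hβ.injOn
    ((degree_sub_lt_of_monic hf hg hfn hgn).trans ?_) fun i _ => (hfe i).trans (hge i).symm
  exact_mod_cast hn

theorem exists_monicInterpolant {n : ℕ} {β : ι → F} (hβ : Function.Injective β)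
    (δ : ι → F) (hn : Fintype.card ι ≤ n) : Nonempty (MonicInterpolant n β δ) := by
  classical
  set P := Lagrange.nodal Finset.univ β
  set L := Lagrange.interpolate Finset.univ β δ
  have hPX : (P * X ^ (n - Fintype.card ι)).Monic := Lagrange.nodal_monic.mul (monic_X_pow _)
  have hPXn : (P * X ^ (n - Fintype.card ι)).natDegree = n := by
    rw [Lagrange.nodal_monic.natDegree_mul (monic_X_pow _), natDegree_X_pow,
      Lagrange.natDegree_nodal, Finset.card_univ]
    omega
  have hLlt : L.degree < (P * X ^ (n - Fintype.card ι)).degree := by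
    rw [degree_eq_natDegree hPX.ne_zero, hPXn]
    refine (Lagrange.degree_interpolate_lt δ hβ.injOn).trans_le ?_
    exact_mod_cast hn
  refine ⟨⟨P * X ^ (n - Fintype.card ι) + L, hPX.add_of_left hLlt, ?_, fun i => ?_⟩⟩
  · rw [natDegree_add_eq_left_of_degree_lt hLlt, hPXn]
  · rw [eval_add, eval_mul, Lagrange.eval_nodal_at_node (Finset.mem_univ i), zero_mul, zero_add,
      Lagrange.eval_interpolate_at_node δ hβ.injOn (Finset.mem_univ i)]

theorem card_monicInterpolant [Fintype F] {n : ℕ} {β : ι → F} (hβ : Function.Injective β)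
    (δ : ι → F) (hn : Fintype.card ι ≤ n) :
    Nat.card (MonicInterpolant n β δ) = Fintype.card F ^ (n - Fintype.card ι) := by
  obtain ⟨f₀, hf₀, hf₀n, hf₀e⟩ := exists_monicInterpolant hβ δ hn
  set P := Lagrange.nodal Finset.univ β with hP
  have hPd : P.degree = Fintype.card ι := by rw [hP, Lagrange.degree_nodal, Finset.card_univ]
  have hPr (r : F[X]) : (P * r).degree < n ↔ r.degree < (n - Fintype.card ι : ℕ) := by
    rcases eq_or_ne r 0 with rfl | hr
    · simp
    · rw [degree_mul, hPd, degree_eq_natDegree hr]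
      norm_cast
      omega
  have hf₀d : f₀.degree = n := by rw [degree_eq_natDegree hf₀.ne_zero, hf₀n]
  have hlt (r : degreeLT F (n - Fintype.card ι)) : (P * r.1).degree < f₀.degree :=
    hf₀d ▸ (hPr r).2 (mem_degreeLT.1 r.2)
  let φ : degreeLT F (n - Fintype.card ι) → MonicInterpolant n β δ := fun r =>
    ⟨f₀ + P * r.1, hf₀.add_of_left (hlt r),
      (natDegree_add_eq_left_of_degree_lt (hlt r)).trans hf₀n,
      fun i => by simp [hP, Lagrange.eval_nodal_at_node, hf₀e]⟩
  have hφ : Function.Bijective φ := by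
    constructor
    · intro r s h
      have h' : f₀ + P * r.1 = f₀ + P * s.1 := congrArg Subtype.val h
      exact Subtype.ext (mul_left_cancel₀ Lagrange.nodal_monic.ne_zero (add_left_cancel h'))
    · rintro ⟨f, hf, hfn, hfe⟩
      obtain ⟨r, hr⟩ := nodal_dvd_of_eval_eq_zero hβ (f := f - f₀) fun i => by
        simp [hfe, hf₀e]
      have hd := degree_sub_lt_of_monic hf hf₀ hfn hf₀n
      rw [hr] at hd
      refine ⟨⟨r, mem_degreeLT.2 ((hPr r).1 hd)⟩, Subtype.ext ?_⟩
      change f₀ + P * r = f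
      rw [← hr, add_sub_cancel]
  rw [← Nat.card_congr (Equiv.ofBijective φ hφ),
    Nat.card_congr (degreeLTEquiv F (n - Fintype.card ι)).toEquiv]
  simp

/-- Multiplication by a monic `G`, nonvanishing at every node, identifies monic interpolants
with the monic multiples of `G` having the correspondingly scaled values. -/
noncomputable def monicInterpolantEquivMultiples {G : F[X]} (hG : G.Monic) (n : ℕ)
    (β δ : ι → F) (hGβ : ∀ i, G.eval (β i) ≠ 0) :
    MonicInterpolant n β δ ≃ {f : F[X] // f.Monic ∧ f.natDegree = G.natDegree + n ∧ G ∣ f ∧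
      ∀ i, f.eval (β i) = G.eval (β i) * δ i} :=
  Equiv.ofBijective
    (fun h => ⟨G * h.1, hG.mul h.2.1, by rw [hG.natDegree_mul h.2.1, h.2.2.1],
      dvd_mul_right _ _, fun i => by rw [eval_mul, h.2.2.2]⟩) <| by
    constructor
    · intro g h hgh
      exact Subtype.ext (mul_left_cancel₀ hG.ne_zero (congrArg Subtype.val hgh))
    · rintro ⟨_, hf, hfn, ⟨h, rfl⟩, hfe⟩
      have hh := hG.of_mul_monic_left hf
      refine ⟨⟨h, hh, ?_, fun i => ?_⟩, rfl⟩
      · rw [hG.natDegree_mul hh] at hfn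
        omega
      · exact mul_left_cancel₀ (hGβ i) (by rw [← eval_mul, hfe])

theorem eval_ne_zero_of_eq_one_or_irreducible {G : F[X]} (hG : G.Monic)
    (hG' : G = 1 ∨ Irreducible G) {b : F} (hb : G ≠ X - C b) : G.eval b ≠ 0 := by
  rcases hG' with rfl | hirr
  · simp
  · intro h
    have hdvd : X - C b ∣ G := dvd_iff_isRoot.2 h
    exact hb (eq_of_monic_of_associated hG (monic_X_sub_C b)
      ((irreducible_X_sub_C b).associated_of_dvd hirr hdvd).symm)

end MonicInterpolation

/-- **Lemma 3.3 (counting lemma).** Let `β 1, …, β m ∈ F_q` be distinct and `γ 1, …, γ m ∈ F_q`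
arbitrary.  Let `G₀` be monic of degree `j₀`, either equal to `1` or irreducible, let `G₁` be
monic of degree `j₁`, and set `G = G₀G₁`, `j = j₀ + j₁`.  Let `N` be the number of monic
`f ∈ F_q[x]` with `deg f = j`, `G₀ ∣ f` and `f(β i) = γ i ⬝ G(β i)` for all `i`.  Then:
(1) if `j < m` then `N ≤ 1`;
(2) if `j₁ < m ≤ j` and `G₀ ≠ x - β i` for every `i`, then `N ≤ 1`;
(3) if `j ≥ m` and `G₀ = 1` or `G₀ = x - β i` for some `i`, then `N = q^(j-m)`;
(4) if `j₁ ≥ m` and `G₀ ≠ x - β i` for every `i`, then `N = q^(j₁-m)`. -/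
theorem count_monic_multiples_with_values
    (q : ℕ) (F : Type) [Field F] [Fintype F] (hF : Fintype.card F = q)
    (m j₀ j₁ : ℕ) (β γ : Fin m → F) (hβ : Function.Injective β)
    (G₀ G₁ : Polynomial F) (hG₀monic : G₀.Monic) (hG₀deg : G₀.natDegree = j₀)
    (hG₀ : G₀ = 1 ∨ Irreducible G₀) (hG₁monic : G₁.Monic) (hG₁deg : G₁.natDegree = j₁)
    (N : ℕ)
    (hN : N = Nat.card {f : Polynomial F // f.Monic ∧ f.natDegree = j₀ + j₁ ∧ G₀ ∣ f ∧
        ∀ i, f.eval (β i) = γ i * (G₀ * G₁).eval (β i)}) :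
    (j₀ + j₁ < m → N ≤ 1) ∧
    (j₁ < m → m ≤ j₀ + j₁ → (∀ i, G₀ ≠ X - C (β i)) → N ≤ 1) ∧
    (m ≤ j₀ + j₁ → (G₀ = 1 ∨ ∃ i, G₀ = X - C (β i)) → N = q ^ (j₀ + j₁ - m)) ∧
    (m ≤ j₁ → (∀ i, G₀ ≠ X - C (β i)) → N = q ^ (j₁ - m)) := by
  have hcop (hne : ∀ i, G₀ ≠ X - C (β i)) :
      N = Nat.card (MonicInterpolant j₁ β fun i => γ i * G₁.eval (β i)) := by
    rw [hN, Nat.card_congr (monicInterpolantEquivMultiples hG₀monic j₁ β _ fun i =>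
      eval_ne_zero_of_eq_one_or_irreducible hG₀monic hG₀ (hne i)), hG₀deg]
    simp only [eval_mul, mul_left_comm]
  refine ⟨fun hj => ?_, fun hj₁ _ hne => ?_, fun hj hlin => ?_, fun hj₁ hne => ?_⟩
  · have := subsingleton_monicInterpolant hβ (fun i => γ i * (G₀ * G₁).eval (β i))
      (n := j₀ + j₁) (by simpa using hj)
    rw [hN, ← Nat.card_unique (α := Unit)]
    exact Nat.card_le_card_of_injective (fun _ => ()) fun f g _ => Subtype.ext <|
      Subtype.mk.inj <| this.elim ⟨f.1, f.2.1, f.2.2.1, f.2.2.2.2⟩ ⟨g.1, g.2.1, g.2.2.1, g.2.2.2.2⟩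
  · have := subsingleton_monicInterpolant hβ (fun i => γ i * G₁.eval (β i)) (n := j₁)
      (by simpa using hj₁)
    rw [hcop hne]
    exact Finite.card_le_one_iff_subsingleton.2 this
  · have hdvd (f : F[X]) (hf : ∀ i, f.eval (β i) = γ i * (G₀ * G₁).eval (β i)) : G₀ ∣ f := by
      rcases hlin with rfl | ⟨i, rfl⟩
      · exact one_dvd f
      · exact dvd_iff_isRoot.2 (by simp [IsRoot, hf])
    have hcard := card_monicInterpolant hβ (fun i => γ i * (G₀ * G₁).eval (β i))
      (n := j₀ + j₁) (by simpa using hj)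
    rw [Fintype.card_fin, hF] at hcard
    rw [hN, ← hcard]
    exact Nat.card_congr (Equiv.subtypeEquivRight fun f =>
      ⟨fun h => ⟨h.1, h.2.1, h.2.2.2⟩, fun h => ⟨h.1, h.2.1, hdvd f h.2.2, h.2.2⟩⟩)
  · rw [hcop hne, card_monicInterpolant hβ _ (by simpa using hj₁), Fintype.card_fin, hF]
end
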